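/- arXiv:1308.4247 — 2 statements merged into one kernel-verified Lean document; each statement's English description precedes it below -/
import Mathlib

section
/- Let γ : [0,L] → ℝ² be a smooth unit-speed curve whose curvature κ(t) satisfies 0 < K_min ≤ κ(t) ≤ K_max and whose total curvature ∫₀^L κ(t) dt is less than π/2. There is a constant C₀ > 0 depending only on the curve such that for every λ ≥ 1, every family of C¹ functions h_μ : [0,L] → ℂ indexed by μ ∈ E_λ, and every family of coefficients a_μ ∈ ℂ with Σ_{μ∈E_λ} |a_μ|² = 1, the function H(t) = Σ_{μ∈E_λ} a_μ h_μ(t) e^{i⟨μ, γ(t)⟩} satisfies ∫₀^L |H(t)|² dt ≤ 2·max_{μ∈E_λ} ‖h_μ‖²_{L²[0,L]} + C₀·(#E_λ/λ^{1/6})·( max_{μ∈E_λ} ‖h_μ‖²_∞ + max_{μ∈E_λ} ‖h_μ‖_∞ · max_{μ∈E_λ} ‖h_μ'‖_{L¹[0,L]} ). -/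
open MeasureTheory Real

noncomputable section

/-- The Euclidean norm of a vector in `ℝ × ℝ`. -/
def e2 (x : ℝ × ℝ) : ℝ := Real.sqrt (x.1 ^ 2 + x.2 ^ 2)

/-- The integer vector `μ` viewed as a vector in `ℝ × ℝ`. -/
def iv (μ : ℤ × ℤ) : ℝ × ℝ := ((μ.1 : ℝ), (μ.2 : ℝ))

/-- The set of lattice points on the circle of radius `lam`. -/
def Elat (lam : ℝ) : Finset (ℤ × ℤ) := by
  classical
  exact (Finset.Icc (-⌈lam⌉, -⌈lam⌉) (⌈lam⌉, ⌈lam⌉)).filter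
    (fun μ => (μ.1 : ℝ) ^ 2 + (μ.2 : ℝ) ^ 2 = lam ^ 2)

/-- `B_lam`: the maximal number of lattice points on the circle of radius `lam`
lying in an arc of length `√lam`. -/
def Bmax (lam : ℝ) : ℕ := by
  classical
  exact sSup {n : ℕ | ∃ x : ℝ × ℝ, e2 x = lam ∧
    n = ((Elat lam).filter fun ξ => e2 (iv ξ - x) ≤ Real.sqrt lam).card}

/-- The sublevel estimate `∫ 1 / (1 + r ψ²) = O(r^{-1/2})` when `ψ` and `ψ'` do not vanish
simultaneously. -/
lemma integral_inv_one_add_mul_sq_le {ψ ψ₁ ψ₂ : ℝ → ℝ} {x r M C : ℝ} (hx : 0 ≤ x)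
    (hr : 1 ≤ r) (hC : 0 ≤ C)
    (h0 : ∀ t, HasDerivAt ψ (ψ₁ t) t) (h1 : ∀ t, HasDerivAt ψ₁ (ψ₂ t) t) (h2 : Continuous ψ₂)
    (b1 : ∀ t ∈ Set.Icc 0 x, |ψ₁ t| ≤ M) (b2 : ∀ t ∈ Set.Icc 0 x, |ψ₂ t| ≤ M)
    (hlow : ∀ t ∈ Set.Icc 0 x, 1 ≤ C * (ψ t ^ 2 + ψ₁ t ^ 2)) :
    (∫ t in (0 : ℝ)..x, 1 / (1 + r * ψ t ^ 2)) ≤ C * (x + 4 * M + 2 * M * x) / √r := by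
  have hM : 0 ≤ M := (abs_nonneg _).trans (b1 0 ⟨le_rfl, hx⟩)
  have hs1 : 1 ≤ √r := Real.one_le_sqrt.2 hr
  have hs : 0 < √r := by linarith
  have hss : √r * √r = r := Real.mul_self_sqrt (by linarith)
  have c0 : Continuous ψ := continuous_iff_continuousAt.2 fun t => (h0 t).continuousAt
  have c1 : Continuous ψ₁ := continuous_iff_continuousAt.2 fun t => (h1 t).continuousAt
  have hden : ∀ t, 0 < 1 + r * ψ t ^ 2 := fun t => by
    have := sq_nonneg (ψ t); have := mul_nonneg (by linarith : 0 ≤ r) this; linarith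
  have harc : ∀ y : ℝ, |Real.arctan y| ≤ 2 := fun y => by
    rw [abs_le]
    constructor <;> linarith [Real.arctan_lt_pi_div_two y, Real.neg_pi_div_two_lt_arctan y,
      Real.pi_le_four]
  set G : ℝ → ℝ := fun t => ψ₁ t * Real.arctan (√r * ψ t) / √r with hG
  set G' : ℝ → ℝ := fun t =>
    ψ₂ t * Real.arctan (√r * ψ t) / √r + ψ₁ t ^ 2 / (1 + r * ψ t ^ 2) with hG'
  have hGd : ∀ t, HasDerivAt G (G' t) t := fun t => by
    have := ((h1 t).mul (((h0 t).const_mul (√r)).arctan)).div_const (√r)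
    refine this.congr_deriv ?_
    have e : 1 + (√r * ψ t) ^ 2 = 1 + r * ψ t ^ 2 := by rw [mul_pow, Real.sq_sqrt (by linarith)]
    have := (hden t).ne'
    simp only [hG', e]
    field_simp
  have hG'c : Continuous G' := by
    have := fun t => (hden t).ne'
    simp only [hG']
    fun_prop (disch := assumption)
  have hFTC : ∫ t in (0 : ℝ)..x, G' t = G x - G 0 :=
    intervalIntegral.integral_eq_sub_of_hasDerivAt (fun t _ => hGd t)
      (hG'c.intervalIntegrable _ _)
  have hGb : ∀ t ∈ Set.Icc 0 x, |G t| ≤ 2 * M / √r := fun t ht => by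
    have : |ψ₁ t| * |Real.arctan (√r * ψ t)| ≤ M * 2 :=
      mul_le_mul (b1 t ht) (harc _) (abs_nonneg _) hM
    rw [hG, abs_div, abs_mul, abs_of_pos hs]
    exact div_le_div_of_nonneg_right (by linarith) hs.le
  have hptw : ∀ t ∈ Set.Icc 0 x,
      1 / (1 + r * ψ t ^ 2) ≤ C * ((1 + 2 * M) / √r + G' t) := fun t ht => by
    have hd := hden t
    have e1 : ψ t ^ 2 / (1 + r * ψ t ^ 2) ≤ 1 / √r := by
      rw [div_le_div_iff₀ hd hs]
      nlinarith [mul_nonneg (sq_nonneg (ψ t)) (by nlinarith : 0 ≤ r - √r)]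
    have e2 : -(2 * M / √r) ≤ ψ₂ t * Real.arctan (√r * ψ t) / √r := by
      rw [← neg_div]
      gcongr
      have : |ψ₂ t * Real.arctan (√r * ψ t)| ≤ 2 * M := by
        rw [abs_mul]
        nlinarith [b2 t ht, harc (√r * ψ t), abs_nonneg (ψ₂ t),
          abs_nonneg (Real.arctan (√r * ψ t))]
      linarith [(abs_le.1 this).1]
    have e3 : 1 / (1 + r * ψ t ^ 2) ≤
        C * (ψ t ^ 2 / (1 + r * ψ t ^ 2) + ψ₁ t ^ 2 / (1 + r * ψ t ^ 2)) := by
      rw [← add_div, ← mul_div_assoc]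
      gcongr
      exact hlow t ht
    refine e3.trans (mul_le_mul_of_nonneg_left ?_ hC)
    rw [hG', add_div]
    linarith
  calc (∫ t in (0 : ℝ)..x, 1 / (1 + r * ψ t ^ 2))
      ≤ ∫ t in (0 : ℝ)..x, C * ((1 + 2 * M) / √r + G' t) := by
        refine intervalIntegral.integral_mono_on hx ?_ ?_ hptw
        · refine Continuous.intervalIntegrable ?_ _ _
          have := fun t => (hden t).ne'
          fun_prop (disch := assumption)
        · exact Continuous.intervalIntegrable (by fun_prop) _ _
    _ = C * (x * ((1 + 2 * M) / √r) + (G x - G 0)) := by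
        rw [intervalIntegral.integral_const_mul, intervalIntegral.integral_add
          (by simp) (hG'c.intervalIntegrable _ _), hFTC, intervalIntegral.integral_const,
          smul_eq_mul, sub_zero]
    _ ≤ C * (x * ((1 + 2 * M) / √r) + (2 * M / √r + 2 * M / √r)) := by
        have g1 := (abs_le.1 (hGb x ⟨hx, le_rfl⟩)).2
        have g2 := (abs_le.1 (hGb 0 ⟨le_rfl, hx⟩)).1
        gcongr
        linarith
    _ = C * (x + 4 * M + 2 * M * x) / √r := by
        field_simp
        ring

/-- Van der Corput type bound: `∫ e^{iφ} = O(r^{-1/2})` for a phase with `φ' = r ψ`, where `ψ` and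
`ψ'` do not vanish simultaneously. -/
lemma norm_integral_exp_phase_le {φ ψ ψ₁ ψ₂ : ℝ → ℝ} {x r M C : ℝ} (hx : 0 ≤ x)
    (hr : 1 ≤ r) (hC : 0 ≤ C) (hφ : ∀ t, HasDerivAt φ (r * ψ t) t)
    (h0 : ∀ t, HasDerivAt ψ (ψ₁ t) t) (h1 : ∀ t, HasDerivAt ψ₁ (ψ₂ t) t) (h2 : Continuous ψ₂)
    (b1 : ∀ t ∈ Set.Icc 0 x, |ψ₁ t| ≤ M) (b2 : ∀ t ∈ Set.Icc 0 x, |ψ₂ t| ≤ M)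
    (hlow : ∀ t ∈ Set.Icc 0 x, 1 ≤ C * (ψ t ^ 2 + ψ₁ t ^ 2)) :
    ‖∫ t in (0 : ℝ)..x, Complex.exp (Complex.I * (φ t : ℂ))‖ ≤
      (2 + (M + 1) * (C * (x + 4 * M + 2 * M * x))) / √r := by
  have hM : 0 ≤ M := (abs_nonneg _).trans (b1 0 ⟨le_rfl, hx⟩)
  have hs1 : 1 ≤ √r := Real.one_le_sqrt.2 hr
  have hs : 0 < √r := by linarith
  have hss : √r * √r = r := Real.mul_self_sqrt (by linarith)
  have cφ : Continuous φ := continuous_iff_continuousAt.2 fun t => (hφ t).continuousAt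
  have c0 : Continuous ψ := continuous_iff_continuousAt.2 fun t => (h0 t).continuousAt
  have c1 : Continuous ψ₁ := continuous_iff_continuousAt.2 fun t => (h1 t).continuousAt
  have hden : ∀ t, 0 < 1 + r * ψ t ^ 2 := fun t => by
    have := sq_nonneg (ψ t); have := mul_nonneg (by linarith : 0 ≤ r) this; linarith
  have hden' := fun t => (hden t).ne'
  set E : ℝ → ℂ := fun t => Complex.exp (Complex.I * (φ t : ℂ)) with hE
  have hEn : ∀ t, ‖E t‖ = 1 := fun t => by
    rw [hE]; simp only [mul_comm Complex.I]; exact Complex.norm_exp_ofReal_mul_I _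
  have hEc : Continuous E := by fun_prop
  have hEd : ∀ t, HasDerivAt E (E t * (Complex.I * ((r * ψ t : ℝ) : ℂ))) t := fun t =>
    ((hφ t).ofReal_comp.const_mul Complex.I).cexp
  set w : ℝ → ℝ := fun t => ψ t / (1 + r * ψ t ^ 2) with hw
  set w' : ℝ → ℝ := fun t => ψ₁ t * (1 - r * ψ t ^ 2) / (1 + r * ψ t ^ 2) ^ 2 with hw'
  set q : ℝ → ℝ := fun t => 1 / (1 + r * ψ t ^ 2) with hq
  have hqc : Continuous q := by
    simp only [hq]; fun_prop (disch := assumption)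
  have hwd : ∀ t, HasDerivAt w (w' t) t := fun t => by
    refine ((h0 t).div ((((h0 t).pow 2).const_mul r).const_add 1) (hden' t)).congr_deriv ?_
    simp only [hw']
    congr 1
    simp
    ring
  have hw'c : Continuous w' := by
    have : ∀ t, (1 + r * ψ t ^ 2) ^ 2 ≠ 0 := fun t => pow_ne_zero _ (hden' t)
    simp only [hw']
    fun_prop (disch := assumption)
  have hwb : ∀ t, |w t| ≤ 1 / √r := fun t => by
    rw [hw, abs_div, abs_of_pos (hden t), div_le_div_iff₀ (hden t) hs]
    nlinarith [sq_nonneg (√r * |ψ t| - 1), sq_abs (ψ t), mul_nonneg hs.le (abs_nonneg (ψ t))]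
  have hw'b : ∀ t ∈ Set.Icc 0 x, |w' t| ≤ M * q t := fun t ht => by
    have h := hden t
    have h3 : 0 ≤ r * ψ t ^ 2 := mul_nonneg (by linarith) (sq_nonneg _)
    have h4 : |1 - r * ψ t ^ 2| ≤ 1 + r * ψ t ^ 2 := by
      rw [abs_le]; constructor <;> linarith
    have : |w' t| ≤ M * (1 + r * ψ t ^ 2) / (1 + r * ψ t ^ 2) ^ 2 := by
      rw [hw', abs_div, abs_mul, abs_of_pos (pow_pos h 2)]
      gcongr
      exact b1 t ht
    refine this.trans_eq ?_
    simp only [hq]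
    field_simp
  set R : ℝ → ℂ := fun t => ((w' t : ℂ) - Complex.I * (q t : ℂ)) * E t with hR
  have hRc : Continuous R := by fun_prop
  have hFd : ∀ t, HasDerivAt (fun t => (w t : ℂ) * E t) (R t + Complex.I * E t) t := fun t => by
    refine ((hwd t).ofReal_comp.mul (hEd t)).congr_deriv ?_
    have e : w t * (r * ψ t) = 1 - q t := by
      have := hden' t
      simp only [hw, hq]; field_simp; ring
    have e' : (w t : ℂ) * ((r * ψ t : ℝ) : ℂ) = 1 - (q t : ℂ) := by exact_mod_cast e
    simp only [hR]
    linear_combination (E t * Complex.I) * e'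
  have hFTC : ∫ t in (0 : ℝ)..x, (R t + Complex.I * E t) = (w x : ℂ) * E x - (w 0 : ℂ) * E 0 :=
    intervalIntegral.integral_eq_sub_of_hasDerivAt (fun t _ => hFd t)
      (Continuous.intervalIntegrable (by fun_prop) _ _)
  rw [intervalIntegral.integral_add (hRc.intervalIntegrable _ _)
    (Continuous.intervalIntegrable (by fun_prop) _ _), intervalIntegral.integral_const_mul] at hFTC
  have hRb : ‖∫ t in (0 : ℝ)..x, R t‖ ≤ (M + 1) * (C * (x + 4 * M + 2 * M * x) / √r) := by
    calc ‖∫ t in (0 : ℝ)..x, R t‖ ≤ ∫ t in (0 : ℝ)..x, (M + 1) * q t := by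
          refine intervalIntegral.norm_integral_le_of_norm_le hx ?_
            (Continuous.intervalIntegrable (by fun_prop) _ _)
          filter_upwards with t ht
          have hqp : 0 ≤ q t := (one_div_pos.2 (hden t)).le
          simp only [hR]
          rw [norm_mul, hEn, mul_one]
          refine (norm_sub_le _ _).trans ?_
          rw [norm_mul, Complex.norm_I, one_mul, Complex.norm_real, Complex.norm_real,
            Real.norm_eq_abs, Real.norm_eq_abs, abs_of_nonneg hqp]
          linarith [hw'b t ⟨ht.1.le, ht.2⟩]
      _ ≤ _ := by
          rw [intervalIntegral.integral_const_mul]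
          exact mul_le_mul_of_nonneg_left
            (integral_inv_one_add_mul_sq_le hx hr hC h0 h1 h2 b1 b2 hlow) (by linarith)
  have hwE : ∀ t, ‖(w t : ℂ) * E t‖ ≤ 1 / √r := fun t => by
    rw [norm_mul, hEn, mul_one, Complex.norm_real]; exact hwb t
  calc ‖∫ t in (0 : ℝ)..x, E t‖ = ‖Complex.I * ∫ t in (0 : ℝ)..x, E t‖ := by
        rw [norm_mul, Complex.norm_I, one_mul]
    _ = ‖(w x : ℂ) * E x - (w 0 : ℂ) * E 0 - ∫ t in (0 : ℝ)..x, R t‖ := by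
        rw [← hFTC]; congr 1; ring
    _ ≤ (1 / √r + 1 / √r) + (M + 1) * (C * (x + 4 * M + 2 * M * x) / √r) := by
        refine (norm_sub_le _ _).trans (add_le_add ((norm_sub_le _ _).trans ?_) hRb)
        exact add_le_add (hwE x) (hwE 0)
    _ = _ := by field_simp; ring

/-- Integration by parts: the primitive of `E` bounds the integral of `g E` by the total
variation of `g`. -/
lemma norm_integral_mul_le_of_primitive {g g' E : ℝ → ℂ} {L Q : ℝ} (hL : 0 ≤ L)
    (hg : ∀ t, HasDerivAt g (g' t) t) (hg' : Continuous g') (hE : Continuous E)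
    (hQ : ∀ x ∈ Set.Icc 0 L, ‖∫ t in (0 : ℝ)..x, E t‖ ≤ Q) :
    ‖∫ t in (0 : ℝ)..L, g t * E t‖ ≤ Q * (‖g L‖ + ∫ t in (0 : ℝ)..L, ‖g' t‖) := by
  have hd : ∀ x, HasDerivAt (fun x => ∫ t in (0 : ℝ)..x, E t) (E x) x := fun x =>
    hE.integral_hasStrictDerivAt 0 x |>.hasDerivAt
  have hP : Continuous fun x => ∫ t in (0 : ℝ)..x, E t :=
    continuous_iff_continuousAt.2 fun t => (hd t).continuousAt
  rw [intervalIntegral.integral_mul_deriv_eq_deriv_mul (fun t _ => hg t) (fun t _ => hd t)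
    (hg'.intervalIntegrable _ _) (hE.intervalIntegrable _ _)]
  simp only [intervalIntegral.integral_same, mul_zero, sub_zero]
  refine (norm_sub_le _ _).trans ?_
  rw [mul_add]
  refine add_le_add ?_ ?_
  · rw [norm_mul, mul_comm]
    exact mul_le_mul_of_nonneg_right (hQ L ⟨hL, le_rfl⟩) (norm_nonneg _)
  · rw [← intervalIntegral.integral_const_mul]
    refine intervalIntegral.norm_integral_le_of_norm_le hL ?_
      (Continuous.intervalIntegrable (by fun_prop) _ _)
    filter_upwards with t ht
    rw [norm_mul, mul_comm]
    exact mul_le_mul_of_nonneg_right (hQ t ⟨ht.1.le, ht.2⟩) (norm_nonneg _)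

lemma hasDerivAt_const_mul_fst_add_const_mul_snd {f : ℝ → ℝ × ℝ} {f' : ℝ × ℝ} {t : ℝ}
    (c d : ℝ) (hf : HasDerivAt f f' t) :
    HasDerivAt (fun t => c * (f t).1 + d * (f t).2) (c * f'.1 + d * f'.2) t :=
  (c • ContinuousLinearMap.fst ℝ ℝ ℝ +
    d • ContinuousLinearMap.snd ℝ ℝ ℝ).hasFDerivAt.comp_hasDerivAt t hf

/-- Decay of the Fourier transform of arc length on a unit-speed plane curve with nonvanishing
curvature. -/
lemma exists_norm_integral_exp_curve_le {L Kmin : ℝ} {γ : ℝ → ℝ × ℝ} (hL : 0 < L)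
    (hKmin : 0 < Kmin) (hsmooth : ContDiff ℝ (⊤ : ℕ∞) γ)
    (hunit : ∀ t ∈ Set.Icc (0 : ℝ) L, e2 (deriv γ t) = 1)
    (hcurv : ∀ t ∈ Set.Icc (0 : ℝ) L, Kmin ≤ e2 (deriv (deriv γ) t)) :
    ∃ K > (0 : ℝ), ∀ r : ℝ, 1 ≤ r → ∀ ξ : ℝ × ℝ, e2 ξ = r → ∀ x ∈ Set.Icc (0 : ℝ) L,
      ‖∫ t in (0 : ℝ)..x, Complex.exp (Complex.I *
        Complex.ofReal (ξ.1 * (γ t).1 + ξ.2 * (γ t).2))‖ ≤ K / √r := by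
  have s1 : ContDiff ℝ (⊤ : ℕ∞) (deriv γ) := (contDiff_infty_iff_deriv.1 hsmooth).2
  have s2 : ContDiff ℝ (⊤ : ℕ∞) (deriv (deriv γ)) := (contDiff_infty_iff_deriv.1 s1).2
  have s3 : ContDiff ℝ (⊤ : ℕ∞) (deriv (deriv (deriv γ))) := (contDiff_infty_iff_deriv.1 s2).2
  have d0 : ∀ t, HasDerivAt γ (deriv γ t) t := fun t =>
    ((contDiff_infty_iff_deriv.1 hsmooth).1 t).hasDerivAt
  have d1 : ∀ t, HasDerivAt (deriv γ) (deriv (deriv γ) t) t := fun t =>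
    ((contDiff_infty_iff_deriv.1 s1).1 t).hasDerivAt
  have d2 : ∀ t, HasDerivAt (deriv (deriv γ)) (deriv (deriv (deriv γ)) t) t := fun t =>
    ((contDiff_infty_iff_deriv.1 s2).1 t).hasDerivAt
  set γ₁ := deriv γ
  set γ₂ := deriv γ₁
  set γ₃ := deriv γ₂
  have hu : ∀ t ∈ Set.Icc (0 : ℝ) L, (γ₁ t).1 ^ 2 + (γ₁ t).2 ^ 2 = 1 := fun t ht => by
    have := hunit t ht
    rwa [e2, Real.sqrt_eq_one] at this
  have hκ : ∀ t ∈ Set.Icc (0 : ℝ) L, Kmin ^ 2 ≤ (γ₂ t).1 ^ 2 + (γ₂ t).2 ^ 2 := fun t ht => by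
    exact (Real.le_sqrt' hKmin).1 (hcurv t ht)
  have horth : ∀ t ∈ Set.Icc (0 : ℝ) L,
      (γ₁ t).1 * (γ₂ t).1 + (γ₁ t).2 * (γ₂ t).2 = 0 := fun t ht => by
    have hfst : HasDerivAt (fun s => (γ₁ s).1) (γ₂ t).1 t := by
      simpa using hasDerivAt_const_mul_fst_add_const_mul_snd 1 0 (d1 t)
    have hsnd : HasDerivAt (fun s => (γ₁ s).2) (γ₂ t).2 t := by
      simpa using hasDerivAt_const_mul_fst_add_const_mul_snd 0 1 (d1 t)
    have h1 := (hfst.pow 2).add (hsnd.pow 2)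
    have h2 : HasDerivWithinAt (fun _ : ℝ => (1 : ℝ)) _ (Set.Icc 0 L) t :=
      h1.hasDerivWithinAt.congr (fun s hs => (hu s hs).symm) (hu t ht).symm
    have := (uniqueDiffOn_Icc hL t ht).eq_deriv _ h2 (hasDerivWithinAt_const t _ (1 : ℝ))
    simp at this
    linarith
  obtain ⟨M₂, hM₂⟩ := isCompact_Icc.exists_bound_of_continuousOn
    (s := Set.Icc 0 L) s2.continuous.continuousOn
  obtain ⟨M₃, hM₃⟩ := isCompact_Icc.exists_bound_of_continuousOn
    (s := Set.Icc 0 L) s3.continuous.continuousOn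
  set M := max M₂ M₃
  have hM0 : 0 ≤ M := (norm_nonneg _).trans ((hM₂ 0 ⟨le_rfl, hL.le⟩).trans (le_max_left _ _))
  set C : ℝ := 1 + 1 / Kmin ^ 2 with hC
  have hC0 : 0 ≤ C := by positivity
  refine ⟨2 + (2 * M + 1) * (C * (L + 4 * (2 * M) + 2 * (2 * M) * L)), by positivity, ?_⟩
  intro r hr ξ hξ x hx
  have hr0 : 0 < r := by linarith
  have hξ2 : ξ.1 ^ 2 + ξ.2 ^ 2 = r ^ 2 := by
    rw [← hξ, e2, Real.sq_sqrt (by positivity)]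
  obtain ⟨c, hc⟩ : ∃ c, c = ξ.1 / r := ⟨_, rfl⟩
  obtain ⟨d, hd⟩ : ∃ d, d = ξ.2 / r := ⟨_, rfl⟩
  have hc' : ξ.1 = r * c := by rw [hc]; field_simp
  have hd' : ξ.2 = r * d := by rw [hd]; field_simp
  have hcd : c ^ 2 + d ^ 2 = 1 := by
    rw [hc', hd'] at hξ2
    have : r ^ 2 * (c ^ 2 + d ^ 2 - 1) = 0 := by linarith
    rcases mul_eq_zero.1 this with h | h
    · exact absurd h (by positivity)
    · linarith
  have hc1 : |c| ≤ 1 := abs_le_one_iff_mul_self_le_one.2 (by nlinarith)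
  have hd1 : |d| ≤ 1 := abs_le_one_iff_mul_self_le_one.2 (by nlinarith)
  have hbound : ∀ v : ℝ × ℝ, ‖v‖ ≤ M → |c * v.1 + d * v.2| ≤ 2 * M := fun v hv => by
    have a1 := (norm_fst_le v).trans hv
    have a2 := (norm_snd_le v).trans hv
    rw [Real.norm_eq_abs] at a1 a2
    calc |c * v.1 + d * v.2| ≤ |c * v.1| + |d * v.2| := abs_add_le _ _
      _ ≤ 1 * M + 1 * M := by
        rw [abs_mul, abs_mul]
        gcongr
      _ = 2 * M := by ring
  have hsub : ∀ t ∈ Set.Icc 0 x, t ∈ Set.Icc 0 L := fun t ht => ⟨ht.1, ht.2.trans hx.2⟩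
  refine (norm_integral_exp_phase_le
    (ψ := fun t => c * (γ₁ t).1 + d * (γ₁ t).2) (ψ₁ := fun t => c * (γ₂ t).1 + d * (γ₂ t).2)
    (ψ₂ := fun t => c * (γ₃ t).1 + d * (γ₃ t).2) (M := 2 * M) (C := C) hx.1 hr hC0
    (fun t => ?_) (fun t => hasDerivAt_const_mul_fst_add_const_mul_snd c d (d1 t))
    (fun t => hasDerivAt_const_mul_fst_add_const_mul_snd c d (d2 t)) ?_
    (fun t ht => hbound _ ((hM₂ t (hsub t ht)).trans (le_max_left _ _)))
    (fun t ht => hbound _ ((hM₃ t (hsub t ht)).trans (le_max_right _ _)))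
    (fun t ht => ?_)).trans ?_
  · refine (hasDerivAt_const_mul_fst_add_const_mul_snd ξ.1 ξ.2 (d0 t)).congr_deriv ?_
    rw [hc', hd']; ring
  · have := s3.continuous
    fun_prop
  · have ht' := hsub t ht
    have u1 := hu t ht'
    have u2 := hκ t ht'
    have u3 := horth t ht'
    generalize (γ₁ t).1 = p at *
    generalize (γ₁ t).2 = q at *
    generalize (γ₂ t).1 = u at *
    generalize (γ₂ t).2 = v at *
    obtain ⟨k, hk⟩ : ∃ k, k = p * v - q * u := ⟨_, rfl⟩
    have e1 : u = -k * q := by rw [hk]; linear_combination (-u) * u1 + p * u3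
    have e2 : v = k * p := by rw [hk]; linear_combination (-v) * u1 + q * u3
    have e3 : Kmin ^ 2 ≤ k ^ 2 := by
      have : u ^ 2 + v ^ 2 = k ^ 2 := by
        rw [e1, e2]; linear_combination k ^ 2 * u1
      linarith
    have e4 : (c * p + d * q) ^ 2 + (d * p - c * q) ^ 2 = 1 := by
      linear_combination (p ^ 2 + q ^ 2) * hcd + u1
    have e5 : (c * u + d * v) ^ 2 = k ^ 2 * (d * p - c * q) ^ 2 := by rw [e1, e2]; ring
    have e6 : (d * p - c * q) ^ 2 ≤ 1 / Kmin ^ 2 * (c * u + d * v) ^ 2 := by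
      rw [e5, one_div, ← div_eq_inv_mul, le_div_iff₀ (by positivity)]
      nlinarith [sq_nonneg (d * p - c * q)]
    have e7 : 0 ≤ 1 / Kmin ^ 2 * (c * p + d * q) ^ 2 := by positivity
    rw [hC]
    nlinarith [sq_nonneg (c * u + d * v)]
  · have hxL := hx.2
    have hMx : M * x ≤ M * L := mul_le_mul_of_nonneg_left hxL hM0
    have hle : x + 4 * (2 * M) + 2 * (2 * M) * x ≤ L + 4 * (2 * M) + 2 * (2 * M) * L := by
      linarith
    have hmul := mul_le_mul_of_nonneg_left (mul_le_mul_of_nonneg_left hle hC0)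
      (by positivity : 0 ≤ 2 * M + 1)
    exact div_le_div_of_nonneg_right (by linarith) (Real.sqrt_nonneg r)

/-- A lattice triangle inscribed in a circle of radius `R` has product of side lengths at least
`2R`. -/
lemma lattice_triangle_sides {μ u v : ℤ × ℤ} {R2 : ℝ}
    (hμ : (μ.1 : ℝ) ^ 2 + (μ.2 : ℝ) ^ 2 = R2) (hu : (u.1 : ℝ) ^ 2 + (u.2 : ℝ) ^ 2 = R2)
    (hv : (v.1 : ℝ) ^ 2 + (v.2 : ℝ) ^ 2 = R2) (hμu : u ≠ μ) (hμv : v ≠ μ) (huv : u ≠ v) :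
    4 * R2 ≤ (((u.1 : ℝ) - μ.1) ^ 2 + ((u.2 : ℝ) - μ.2) ^ 2) *
      (((v.1 : ℝ) - μ.1) ^ 2 + ((v.2 : ℝ) - μ.2) ^ 2) *
      (((u.1 : ℝ) - v.1) ^ 2 + ((u.2 : ℝ) - v.2) ^ 2) := by
  have hpos : ∀ p q : ℤ × ℤ, p ≠ q → 0 < ((p.1 : ℝ) - q.1) ^ 2 + ((p.2 : ℝ) - q.2) ^ 2 := by
    intro p q hpq
    by_contra hcon
    have n1 := sq_nonneg ((p.1 : ℝ) - q.1)
    have n2 := sq_nonneg ((p.2 : ℝ) - q.2)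
    have e1 : ((p.1 : ℝ) - q.1) = 0 := pow_eq_zero_iff two_ne_zero |>.1 (by linarith)
    have e3 : ((p.2 : ℝ) - q.2) = 0 := pow_eq_zero_iff two_ne_zero |>.1 (by linarith)
    apply hpq
    ext
    · exact_mod_cast sub_eq_zero.1 e1
    · exact_mod_cast sub_eq_zero.1 e3
  have p1 := hpos u μ hμu
  have p2 := hpos v μ hμv
  have p3 := hpos u v huv
  have key : (((u.1 : ℝ) - μ.1) ^ 2 + ((u.2 : ℝ) - μ.2) ^ 2) *
      (((v.1 : ℝ) - μ.1) ^ 2 + ((v.2 : ℝ) - μ.2) ^ 2) *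
      (((u.1 : ℝ) - v.1) ^ 2 + ((u.2 : ℝ) - v.2) ^ 2) = 4 * R2 *
      (((u.1 : ℝ) - μ.1) * ((v.2 : ℝ) - μ.2) - ((u.2 : ℝ) - μ.2) * ((v.1 : ℝ) - μ.1)) ^ 2 := by
    generalize (u.1 : ℝ) = u1 at *
    generalize (u.2 : ℝ) = u2 at *
    generalize (v.1 : ℝ) = v1 at *
    generalize (v.2 : ℝ) = v2 at *
    generalize (μ.1 : ℝ) = m1 at *
    generalize (μ.2 : ℝ) = m2 at *
    obtain ⟨a, rfl⟩ : ∃ a, u1 = m1 + a := ⟨u1 - m1, by ring⟩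
    obtain ⟨b, rfl⟩ : ∃ b, u2 = m2 + b := ⟨u2 - m2, by ring⟩
    obtain ⟨c, rfl⟩ : ∃ c, v1 = m1 + c := ⟨v1 - m1, by ring⟩
    obtain ⟨d, rfl⟩ : ∃ d, v2 = m2 + d := ⟨v2 - m2, by ring⟩
    have q1 : a ^ 2 + b ^ 2 = -2 * (m1 * a + m2 * b) := by linarith
    have q2 : c ^ 2 + d ^ 2 = -2 * (m1 * c + m2 * d) := by linarith
    have q3 : (a - c) ^ 2 + (b - d) ^ 2 =
        (a ^ 2 + b ^ 2) + (c ^ 2 + d ^ 2) - 2 * (a * c + b * d) := by ring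
    have q4 : (a ^ 2 + b ^ 2) * (c ^ 2 + d ^ 2) * ((a - c) ^ 2 + (b - d) ^ 2) =
        ((a ^ 2 + b ^ 2) * c - (c ^ 2 + d ^ 2) * a) ^ 2 +
        ((a ^ 2 + b ^ 2) * d - (c ^ 2 + d ^ 2) * b) ^ 2 := by ring
    have q5 : (m1 + a - m1) ^ 2 + (m2 + b - m2) ^ 2 = a ^ 2 + b ^ 2 := by ring
    have q6 : (m1 + c - m1) ^ 2 + (m2 + d - m2) ^ 2 = c ^ 2 + d ^ 2 := by ring
    have q7 : (m1 + a - (m1 + c)) ^ 2 + (m2 + b - (m2 + d)) ^ 2 = (a - c) ^ 2 + (b - d) ^ 2 := by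
      ring
    rw [q5, q6, q7, q4, q1, q2, ← hμ]
    ring
  rw [key]
  have hdet : (1 : ℝ) ≤
      (((u.1 : ℝ) - μ.1) * ((v.2 : ℝ) - μ.2) - ((u.2 : ℝ) - μ.2) * ((v.1 : ℝ) - μ.1)) ^ 2 := by
    have hne : (((u.1 : ℝ) - μ.1) * ((v.2 : ℝ) - μ.2) -
        ((u.2 : ℝ) - μ.2) * ((v.1 : ℝ) - μ.1)) ^ 2 ≠ 0 := fun h0 => by
      rw [h0, mul_zero] at key
      exact (mul_pos (mul_pos p1 p2) p3).ne' key
    have hz : ((u.1 - μ.1) * (v.2 - μ.2) - (u.2 - μ.2) * (v.1 - μ.1)) ^ 2 ≠ 0 := by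
      exact_mod_cast hne
    have : 1 ≤ ((u.1 - μ.1) * (v.2 - μ.2) - (u.2 - μ.2) * (v.1 - μ.1)) ^ 2 :=
      Int.add_one_le_iff.2 (lt_of_le_of_ne (sq_nonneg _) hz.symm)
    exact_mod_cast this
  nlinarith

lemma mem_Elat {lam : ℝ} {μ : ℤ × ℤ} (h : μ ∈ Elat lam) :
    (μ.1 : ℝ) ^ 2 + (μ.2 : ℝ) ^ 2 = lam ^ 2 := by
  unfold Elat at h
  exact (Finset.mem_filter.1 h).2

lemma card_filter_near_le_two {lam : ℝ} (hlam : 1 ≤ lam) {μ : ℤ × ℤ} (hμ : μ ∈ Elat lam) :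
    ((Elat lam).filter fun ν => e2 (iv μ - iv ν) < lam ^ ((1 : ℝ) / 3)).card ≤ 2 := by
  set N := (Elat lam).filter fun ν => e2 (iv μ - iv ν) < lam ^ ((1 : ℝ) / 3)
  set s := lam ^ ((1 : ℝ) / 3) with hs
  have hs0 : 0 < s := Real.rpow_pos_of_pos (by linarith) _
  have hs3 : s ^ 3 = lam := by
    rw [hs, ← Real.rpow_natCast, ← Real.rpow_mul (by linarith)]
    norm_num
  have hdist : ∀ ν ∈ N, ((ν.1 : ℝ) - μ.1) ^ 2 + ((ν.2 : ℝ) - μ.2) ^ 2 < s ^ 2 := fun ν hν => by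
    have := (Finset.mem_filter.1 hν).2
    rw [e2, Real.sqrt_lt' hs0] at this
    simp only [iv, Prod.fst_sub, Prod.snd_sub] at this
    nlinarith
  have herase : (N.erase μ).card ≤ 1 := by
    rw [Finset.card_le_one]
    intro u hu v hv
    by_contra huv
    obtain ⟨hu1, hu2⟩ := Finset.mem_erase.1 hu
    obtain ⟨hv1, hv2⟩ := Finset.mem_erase.1 hv
    have h := lattice_triangle_sides (R2 := lam ^ 2) (mem_Elat hμ)
      (mem_Elat (Finset.mem_filter.1 hu2).1) (mem_Elat (Finset.mem_filter.1 hv2).1) hu1 hv1 huv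
    have du := hdist u hu2
    have dv := hdist v hv2
    have duv : ((u.1 : ℝ) - v.1) ^ 2 + ((u.2 : ℝ) - v.2) ^ 2 ≤ 4 * s ^ 2 := by
      nlinarith [sq_nonneg (((u.1 : ℝ) - μ.1) + (v.1 - μ.1)),
        sq_nonneg (((u.2 : ℝ) - μ.2) + (v.2 - μ.2))]
    have hlt : (((u.1 : ℝ) - μ.1) ^ 2 + ((u.2 : ℝ) - μ.2) ^ 2) *
        (((v.1 : ℝ) - μ.1) ^ 2 + ((v.2 : ℝ) - μ.2) ^ 2) < s ^ 2 * s ^ 2 :=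
      mul_lt_mul'' du dv (by positivity) (by positivity)
    have : (((u.1 : ℝ) - μ.1) ^ 2 + ((u.2 : ℝ) - μ.2) ^ 2) *
        (((v.1 : ℝ) - μ.1) ^ 2 + ((v.2 : ℝ) - μ.2) ^ 2) *
        (((u.1 : ℝ) - v.1) ^ 2 + ((u.2 : ℝ) - v.2) ^ 2) < s ^ 2 * s ^ 2 * (4 * s ^ 2) :=
      lt_of_le_of_lt (mul_le_mul_of_nonneg_left duv (by positivity))
        (mul_lt_mul_of_pos_right hlt (by positivity))
    have e : s ^ 2 * s ^ 2 * (4 * s ^ 2) = 4 * lam ^ 2 := by rw [← hs3]; ring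
    linarith
  have := Finset.pred_card_le_card_erase (s := N) (a := μ)
  omega

lemma e2_neg (x : ℝ × ℝ) : e2 (-x) = e2 x := by simp [e2]

/-- A bilinear form bounded by `M` on pairs in a symmetric relation with at most two neighbours per
point, and by `D` on the remaining pairs, is at most `2M + |S| D` on unit vectors. -/
lemma sum_sum_mul_mul_le {ι : Type*} (S : Finset ι) (near : ι → ι → Prop)
    [∀ i, DecidablePred (near i)] (hsymm : ∀ i j, near i j ↔ near j i)
    (hcard : ∀ i ∈ S, (S.filter (near i)).card ≤ 2) {b : ι → ℝ} (hb : ∀ i, 0 ≤ b i)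
    (hb1 : ∑ i ∈ S, b i ^ 2 = 1) {T : ι → ι → ℝ} {M D : ℝ} (hM : 0 ≤ M) (hD : 0 ≤ D)
    (hTM : ∀ i ∈ S, ∀ j ∈ S, T i j ≤ M) (hTD : ∀ i ∈ S, ∀ j ∈ S, ¬ near i j → T i j ≤ D) :
    ∑ i ∈ S, ∑ j ∈ S, b i * b j * T i j ≤ 2 * M + S.card * D := by
  have hpt : ∀ i ∈ S, ∀ j ∈ S, b i * b j * T i j ≤
      M * ((if near i j then b i ^ 2 else 0) / 2 + (if near j i then b j ^ 2 else 0) / 2) +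
        D * (b i * b j) := by
    intro i hi j hj
    have hbb : 0 ≤ b i * b j := mul_nonneg (hb i) (hb j)
    by_cases hn : near i j
    · have hn' := (hsymm i j).1 hn
      rw [if_pos hn, if_pos hn']
      have h1 := mul_le_mul_of_nonneg_left (hTM i hi j hj) hbb
      have h2 := mul_nonneg hD hbb
      have h3 : b i * b j ≤ b i ^ 2 / 2 + b j ^ 2 / 2 := by nlinarith [sq_nonneg (b i - b j)]
      nlinarith [mul_le_mul_of_nonneg_left h3 hM]
    · have hn' : ¬ near j i := fun h => hn ((hsymm i j).2 h)
      rw [if_neg hn, if_neg hn']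
      have h1 := mul_le_mul_of_nonneg_left (hTD i hi j hj hn) hbb
      linarith
  have hnear : ∑ i ∈ S, ∑ j ∈ S, (if near i j then b i ^ 2 else 0) ≤ 2 := by
    calc ∑ i ∈ S, ∑ j ∈ S, (if near i j then b i ^ 2 else 0)
        = ∑ i ∈ S, ((S.filter (near i)).card : ℝ) * b i ^ 2 := by
          refine Finset.sum_congr rfl fun i _ => ?_
          rw [← Finset.sum_filter, Finset.sum_const, nsmul_eq_mul]
      _ ≤ ∑ i ∈ S, 2 * b i ^ 2 := by
          refine Finset.sum_le_sum fun i hi => ?_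
          have : ((S.filter (near i)).card : ℝ) ≤ 2 := by exact_mod_cast hcard i hi
          gcongr
      _ = 2 := by rw [← Finset.mul_sum, hb1, mul_one]
  have hnear' : ∑ i ∈ S, ∑ j ∈ S, (if near j i then b j ^ 2 else 0) ≤ 2 := by
    rw [Finset.sum_comm]; exact hnear
  have hall : ∑ i ∈ S, ∑ j ∈ S, b i * b j ≤ S.card := by
    rw [← Finset.sum_mul_sum]
    have := sq_sum_le_card_mul_sum_sq (s := S) (f := b)
    rw [hb1] at this
    nlinarith
  calc ∑ i ∈ S, ∑ j ∈ S, b i * b j * T i j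
      ≤ ∑ i ∈ S, ∑ j ∈ S,
        (M * ((if near i j then b i ^ 2 else 0) / 2 + (if near j i then b j ^ 2 else 0) / 2) +
          D * (b i * b j)) :=
        Finset.sum_le_sum fun i hi => Finset.sum_le_sum fun j hj => hpt i hi j hj
    _ = M * ((∑ i ∈ S, ∑ j ∈ S, (if near i j then b i ^ 2 else 0)) / 2 +
          (∑ i ∈ S, ∑ j ∈ S, (if near j i then b j ^ 2 else 0)) / 2) +
          D * ∑ i ∈ S, ∑ j ∈ S, b i * b j := by
        simp only [Finset.sum_add_distrib, ← Finset.mul_sum, ← Finset.sum_div]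
    _ ≤ M * (2 / 2 + 2 / 2) + D * S.card := by gcongr
    _ = 2 * M + S.card * D := by ring

/-- Expansion of the `L²` norm of a finite linear combination. -/
lemma integral_norm_sq_sum_le {ι : Type*} (S : Finset ι) (a : ι → ℂ) {f : ι → ℝ → ℂ} {L : ℝ}
    (hf : ∀ i ∈ S, Continuous (f i)) :
    (∫ t in (0 : ℝ)..L, ‖∑ i ∈ S, a i * f i t‖ ^ 2) ≤
      ∑ i ∈ S, ∑ j ∈ S, ‖a i‖ * ‖a j‖ * ‖∫ t in (0 : ℝ)..L, f i t * star (f j t)‖ := by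
  have hint : ∀ i ∈ S, ∀ j ∈ S, IntervalIntegrable
      (fun t => a i * star (a j) * (f i t * star (f j t))) volume 0 L := fun i hi j hj => by
    have := hf i hi; have := hf j hj
    exact Continuous.intervalIntegrable (by fun_prop) _ _
  have hexp : ((∫ t in (0 : ℝ)..L, ‖∑ i ∈ S, a i * f i t‖ ^ 2 : ℝ) : ℂ) =
      ∑ i ∈ S, ∑ j ∈ S, a i * star (a j) * ∫ t in (0 : ℝ)..L, f i t * star (f j t) := by
    rw [← intervalIntegral.integral_ofReal]
    have : ∀ t, ((‖∑ i ∈ S, a i * f i t‖ ^ 2 : ℝ) : ℂ) =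
        ∑ i ∈ S, ∑ j ∈ S, a i * star (a j) * (f i t * star (f j t)) := fun t => by
      push_cast
      rw [← Complex.mul_conj', map_sum, Finset.sum_mul_sum]
      refine Finset.sum_congr rfl fun i _ => Finset.sum_congr rfl fun j _ => ?_
      simp only [map_mul, Complex.star_def]
      ring
    simp only [this]
    rw [intervalIntegral.integral_finsetSum fun i hi => by
      simpa only [Finset.sum_fn] using IntervalIntegrable.sum S (hint i hi)]
    refine Finset.sum_congr rfl fun i hi => ?_
    rw [intervalIntegral.integral_finsetSum (fun j hj => hint i hi j hj)]
    simp only [intervalIntegral.integral_const_mul]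
  refine (Real.le_norm_self _).trans ?_
  rw [← Complex.norm_real, hexp]
  refine (norm_sum_le _ _).trans (Finset.sum_le_sum fun i _ => (norm_sum_le _ _).trans
    (Finset.sum_le_sum fun j _ => ?_))
  rw [norm_mul, norm_mul, norm_star]

lemma le_biSup_finset {ι : Type*} (S : Finset ι) {f : ι → ℝ} {i : ι} (hi : i ∈ S) :
    f i ≤ ⨆ j ∈ S, f j := by
  classical
  have hval : ∀ j, (⨆ _ : j ∈ S, f j) = if j ∈ S then f j else 0 := fun j => by
    split_ifs with h <;> simp [h]
  have hbdd : BddAbove (Set.range fun j => ⨆ _ : j ∈ S, f j) := by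
    refine ⟨∑ j ∈ S, |f j|, ?_⟩
    rintro _ ⟨j, rfl⟩
    simp only [hval]
    split_ifs with h
    · exact (le_abs_self _).trans
        (Finset.single_le_sum (f := fun j => |f j|) (fun j _ => abs_nonneg _) h)
    · exact Finset.sum_nonneg fun j _ => abs_nonneg _
  calc f i = ⨆ _ : i ∈ S, f i := by rw [hval, if_pos hi]
    _ ≤ _ := le_ciSup hbdd i

/-- Lemma 4.1 (bilinear inequality on the curve): for `H(t) = ∑_{μ ∈ E_lam} a_μ h_μ(t)
e^{i⟨μ,γ(t)⟩}` with `∑ |a_μ|² = 1`, one has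
`‖H‖₂² ≤ 2 max ‖h_μ‖₂² + O((#E_lam/lam^{1/6})(max ‖h_μ‖_∞² + max ‖h_μ‖_∞ · max ‖h_μ'‖₁))`. -/
theorem bilinear_inequality_on_curve
    (L Kmin Kmax : ℝ) (γ : ℝ → ℝ × ℝ)
    (hL : 0 < L) (hKmin : 0 < Kmin)
    (hsmooth : ContDiff ℝ (⊤ : ℕ∞) γ)
    (hunit : ∀ t ∈ Set.Icc (0:ℝ) L, e2 (deriv γ t) = 1)
    (hcurv : ∀ t ∈ Set.Icc (0:ℝ) L,
      Kmin ≤ e2 (deriv (deriv γ) t) ∧ e2 (deriv (deriv γ) t) ≤ Kmax)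
    (htot : (∫ t in (0:ℝ)..L, e2 (deriv (deriv γ) t)) < π / 2) :
    ∃ C0 > (0:ℝ), ∀ lam : ℝ, 1 ≤ lam →
      ∀ h : ℤ × ℤ → ℝ → ℂ, (∀ μ ∈ Elat lam, ContDiff ℝ 1 (h μ)) →
      ∀ a : ℤ × ℤ → ℂ, (∑ μ ∈ Elat lam, ‖a μ‖ ^ 2) = 1 →
        (∫ t in (0:ℝ)..L, ‖∑ μ ∈ Elat lam, a μ * h μ t *
            Complex.exp (Complex.I *
              Complex.ofReal ((μ.1 : ℝ) * (γ t).1 + (μ.2 : ℝ) * (γ t).2))‖ ^ 2)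
          ≤ 2 * (⨆ μ ∈ Elat lam, ∫ t in (0:ℝ)..L, ‖h μ t‖ ^ 2)
            + C0 * (((Elat lam).card : ℝ) / lam ^ ((1:ℝ)/6)) *
              ((⨆ μ ∈ Elat lam, sSup ((fun t => ‖h μ t‖) '' Set.Icc (0:ℝ) L)) ^ 2
                + (⨆ μ ∈ Elat lam, sSup ((fun t => ‖h μ t‖) '' Set.Icc (0:ℝ) L))
                  * (⨆ μ ∈ Elat lam, ∫ t in (0:ℝ)..L, ‖deriv (h μ) t‖)) := by
  obtain ⟨K, hK, hosc⟩ := exists_norm_integral_exp_curve_le hL hKmin hsmooth hunit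
    fun t ht => (hcurv t ht).1
  refine ⟨2 * K, by positivity, ?_⟩
  intro lam hlam h hh a ha
  have hlam0 : 0 < lam := by linarith
  set S := Elat lam
  set M := ⨆ μ ∈ S, ∫ t in (0:ℝ)..L, ‖h μ t‖ ^ 2
  set A := ⨆ μ ∈ S, sSup ((fun t => ‖h μ t‖) '' Set.Icc (0:ℝ) L)
  set B := ⨆ μ ∈ S, ∫ t in (0:ℝ)..L, ‖deriv (h μ) t‖
  have hne : S.Nonempty := Finset.nonempty_of_sum_ne_zero (by rw [ha]; exact one_ne_zero)
  have hc : ∀ μ ∈ S, Continuous (h μ) := fun μ hμ => (hh μ hμ).continuous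
  have hc' : ∀ μ ∈ S, Continuous (deriv (h μ)) := fun μ hμ => (hh μ hμ).continuous_deriv le_rfl
  have hd : ∀ μ ∈ S, ∀ t, HasDerivAt (h μ) (deriv (h μ) t) t := fun μ hμ t =>
    ((hh μ hμ).differentiable one_ne_zero t).hasDerivAt
  have hMle : ∀ μ ∈ S, (∫ t in (0:ℝ)..L, ‖h μ t‖ ^ 2) ≤ M := fun μ hμ =>
    le_biSup_finset S (f := fun μ => ∫ t in (0:ℝ)..L, ‖h μ t‖ ^ 2) hμ
  have hBle : ∀ μ ∈ S, (∫ t in (0:ℝ)..L, ‖deriv (h μ) t‖) ≤ B := fun μ hμ =>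
    le_biSup_finset S (f := fun μ => ∫ t in (0:ℝ)..L, ‖deriv (h μ) t‖) hμ
  have hAle : ∀ μ ∈ S, ∀ t ∈ Set.Icc 0 L, ‖h μ t‖ ≤ A := fun μ hμ t ht => by
    have hbdd : BddAbove ((fun t => ‖h μ t‖) '' Set.Icc (0:ℝ) L) :=
      isCompact_Icc.bddAbove_image (hc μ hμ).norm.continuousOn
    exact (le_csSup hbdd ⟨t, ht, rfl⟩).trans
      (le_biSup_finset S (f := fun μ => sSup ((fun t => ‖h μ t‖) '' Set.Icc (0:ℝ) L)) hμ)
  obtain ⟨μ₀, hμ₀⟩ := hne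
  have hM0 : 0 ≤ M := (intervalIntegral.integral_nonneg hL.le fun t _ => by positivity).trans
    (hMle μ₀ hμ₀)
  have hB0 : 0 ≤ B := (intervalIntegral.integral_nonneg hL.le fun t _ => norm_nonneg _).trans
    (hBle μ₀ hμ₀)
  have hA0 : 0 ≤ A := (norm_nonneg _).trans (hAle μ₀ hμ₀ 0 ⟨le_rfl, hL.le⟩)
  have hγ : Continuous γ := hsmooth.continuous
  set E : ℤ × ℤ → ℝ → ℂ := fun μ t => Complex.exp (Complex.I *
    Complex.ofReal ((μ.1 : ℝ) * (γ t).1 + (μ.2 : ℝ) * (γ t).2)) with hE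
  have hEc : ∀ μ, Continuous (E μ) := fun μ => by simp only [hE]; fun_prop
  have hEn : ∀ μ t, ‖E μ t‖ = 1 := fun μ t => by
    simp only [hE, mul_comm Complex.I]; exact Complex.norm_exp_ofReal_mul_I _
  have hEE : ∀ μ ν t, E μ t * star (E ν t) = Complex.exp (Complex.I *
      Complex.ofReal ((iv μ - iv ν).1 * (γ t).1 + (iv μ - iv ν).2 * (γ t).2)) := fun μ ν t => by
    simp only [hE, Complex.star_def, ← Complex.exp_conj, ← Complex.exp_add, map_mul,
      Complex.conj_I, Complex.conj_ofReal, iv, Prod.fst_sub, Prod.snd_sub]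
    congr 1
    push_cast
    ring
  set T : ℤ × ℤ → ℤ × ℤ → ℝ := fun μ ν =>
    ‖∫ t in (0:ℝ)..L, (h μ t * E μ t) * star (h ν t * E ν t)‖ with hT
  have hTM : ∀ μ ∈ S, ∀ ν ∈ S, T μ ν ≤ M := fun μ hμ ν hν => by
    have i1 : IntervalIntegrable (fun t => ‖h μ t‖ ^ 2) volume 0 L :=
      ((hc μ hμ).norm.pow 2).intervalIntegrable _ _
    have i2 : IntervalIntegrable (fun t => ‖h ν t‖ ^ 2) volume 0 L :=
      ((hc ν hν).norm.pow 2).intervalIntegrable _ _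
    calc T μ ν ≤ ∫ t in (0:ℝ)..L, (‖h μ t‖ ^ 2 + ‖h ν t‖ ^ 2) / 2 := by
          refine intervalIntegral.norm_integral_le_of_norm_le hL.le ?_ ((i1.add i2).div_const 2)
          filter_upwards with t _
          rw [norm_mul, norm_star, norm_mul, norm_mul, hEn, hEn, mul_one, mul_one]
          nlinarith [sq_nonneg (‖h μ t‖ - ‖h ν t‖)]
      _ ≤ M := by
          rw [intervalIntegral.integral_div, intervalIntegral.integral_add i1 i2]
          linarith [hMle μ hμ, hMle ν hν]
  have hTD : ∀ μ ∈ S, ∀ ν ∈ S, ¬ e2 (iv μ - iv ν) < lam ^ ((1 : ℝ) / 3) →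
      T μ ν ≤ 2 * K / lam ^ ((1 : ℝ) / 6) * (A ^ 2 + A * B) := fun μ hμ ν hν hfar => by
    rw [not_lt] at hfar
    have hr1 : 1 ≤ e2 (iv μ - iv ν) := (Real.one_le_rpow hlam (by norm_num)).trans hfar
    have hsqrt : lam ^ ((1 : ℝ) / 6) ≤ √(e2 (iv μ - iv ν)) := by
      refine Real.le_sqrt_of_sq_le (le_trans (le_of_eq ?_) hfar)
      rw [← Real.rpow_natCast, ← Real.rpow_mul hlam0.le]
      norm_num
    have hp : 0 < lam ^ ((1 : ℝ) / 6) := Real.rpow_pos_of_pos hlam0 _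
    have hgd : ∀ t, HasDerivAt (fun t => h μ t * star (h ν t))
        (deriv (h μ) t * star (h ν t) + h μ t * star (deriv (h ν) t)) t := fun t =>
      (hd μ hμ t).mul (hd ν hν t).star
    have k1 := hc μ hμ
    have k2 := hc ν hν
    have k3 := hc' μ hμ
    have k4 := hc' ν hν
    have hibp := norm_integral_mul_le_of_primitive (E := fun t => E μ t * star (E ν t)) hL.le hgd
      (by fun_prop) ((hEc μ).mul (hEc ν).star) (Q := K / √(e2 (iv μ - iv ν))) (fun x hx => by
        simp only [hEE]
        exact hosc _ hr1 _ rfl x hx)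
    have hgL : ‖h μ L * star (h ν L)‖ ≤ A ^ 2 := by
      rw [norm_mul, norm_star, sq]
      exact mul_le_mul (hAle μ hμ L ⟨hL.le, le_rfl⟩) (hAle ν hν L ⟨hL.le, le_rfl⟩)
        (norm_nonneg _) hA0
    have j1 : IntervalIntegrable (fun t => A * ‖deriv (h μ) t‖) volume 0 L :=
      (k3.norm.const_mul A).intervalIntegrable _ _
    have j2 : IntervalIntegrable (fun t => A * ‖deriv (h ν) t‖) volume 0 L :=
      (k4.norm.const_mul A).intervalIntegrable _ _
    have hgi : (∫ t in (0:ℝ)..L, ‖deriv (h μ) t * star (h ν t) + h μ t * star (deriv (h ν) t)‖)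
        ≤ 2 * (A * B) := by
      calc _ ≤ ∫ t in (0:ℝ)..L, (A * ‖deriv (h μ) t‖ + A * ‖deriv (h ν) t‖) := by
            refine intervalIntegral.integral_mono_on hL.le
              (Continuous.intervalIntegrable (by fun_prop) _ _) (j1.add j2) fun t ht => ?_
            refine (norm_add_le _ _).trans ?_
            rw [norm_mul, norm_mul, norm_star, norm_star]
            have m1 := mul_le_mul_of_nonneg_right (hAle μ hμ t ht) (norm_nonneg (deriv (h ν) t))
            have m2 := mul_le_mul_of_nonneg_right (hAle ν hν t ht) (norm_nonneg (deriv (h μ) t))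
            linarith
        _ ≤ 2 * (A * B) := by
            rw [intervalIntegral.integral_add j1 j2, intervalIntegral.integral_const_mul,
              intervalIntegral.integral_const_mul]
            have m1 := mul_le_mul_of_nonneg_left (hBle μ hμ) hA0
            have m2 := mul_le_mul_of_nonneg_left (hBle ν hν) hA0
            linarith
    calc T μ ν = ‖∫ t in (0:ℝ)..L, h μ t * star (h ν t) * (E μ t * star (E ν t))‖ := by
          simp only [hT, star_mul']
          congr 2
          ext t
          ring
      _ ≤ _ := hibp
      _ ≤ K / lam ^ ((1 : ℝ) / 6) * (A ^ 2 + 2 * (A * B)) :=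
          mul_le_mul (div_le_div_of_nonneg_left hK.le hp hsqrt) (add_le_add hgL hgi)
            (add_nonneg (norm_nonneg _)
              (intervalIntegral.integral_nonneg hL.le fun t _ => norm_nonneg _)) (by positivity)
      _ ≤ K / lam ^ ((1 : ℝ) / 6) * (2 * (A ^ 2 + A * B)) := by
          gcongr
          nlinarith [sq_nonneg A]
      _ = 2 * K / lam ^ ((1 : ℝ) / 6) * (A ^ 2 + A * B) := by ring
  classical
  have hsum := sum_sum_mul_mul_le S (fun μ ν => e2 (iv μ - iv ν) < lam ^ ((1 : ℝ) / 3))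
    (fun μ ν => by rw [← e2_neg, neg_sub]) (fun μ hμ => by
      convert card_filter_near_le_two hlam hμ)
    (b := fun μ => ‖a μ‖) (fun μ => norm_nonneg _) ha hM0
    (D := 2 * K / lam ^ ((1 : ℝ) / 6) * (A ^ 2 + A * B)) (by positivity) hTM hTD
  have hexp := integral_norm_sq_sum_le S a (f := fun μ t => h μ t * E μ t) (L := L)
    fun μ hμ => (hc μ hμ).mul (hEc μ)
  simp only [← mul_assoc] at hexp hsum ⊢
  refine hexp.trans (hsum.trans (le_of_eq ?_))
  ring
end
end

section
/- Fix 0 < ε ≤ 1/3. There exist constants C > 0 and λ₀ > 0, depending only on ε, such that for every λ ≥ λ₀ and every family of complex numbers b = (b_z)_{z ∈ Z_λ}, one has Σ |b_z||b_w| / |z−w|₊^{1/2} ≤ C·B_λ·Σ_{z∈Z_λ} |b_z|², where the sum on the left is over all pairs z, w ∈ Z_λ with |z| ≥ λ/2, |w| ≥ λ/2, Δ(z) > √λ, Δ(w) > √λ and |z − w| < λ^ε. -/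
open MeasureTheory Real

noncomputable section

/-- `Z_lam`: the set of medians `(μ+ν)/2` of pairs of lattice points on the circle
of radius `lam`. -/
def Zmed (lam : ℝ) : Finset (ℝ × ℝ) := by
  classical
  exact ((Elat lam) ×ˢ (Elat lam)).image fun p => ((1:ℝ)/2) • (iv p.1 + iv p.2)

/-- `Δ(z) = √(lam² - |z|²)`, half the distance between the two points of the circle of
radius `lam` with midpoint `z`. -/
def Del (lam : ℝ) (z : ℝ × ℝ) : ℝ := Real.sqrt (lam ^ 2 - (e2 z) ^ 2)

/-- Rotation of a plane vector by `π/2`. -/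
def perp (z : ℝ × ℝ) : ℝ × ℝ := (-z.2, z.1)

/-- `μ₊(z) = z + Δ(z)·z^⊥/|z^⊥|`, one of the two points on the circle of radius `lam`
whose midpoint is `z`. -/
def mup (lam : ℝ) (z : ℝ × ℝ) : ℝ × ℝ := z + (Del lam z / e2 z) • perp z

/-- The bilinear sum `∑ |b_z||b_w| / |z-w|₊^{1/2}` over pairs `z, w ∈ Z_lam` satisfying the
predicate `P` and `|z - w| < lam^ε`, where `|x|₊ = max(1,|x|)`. -/
def pairSum (lam ε : ℝ) (P : ℝ × ℝ → Prop) (b : ℝ × ℝ → ℂ) : ℝ := by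
  classical
  exact ∑ p ∈ ((Zmed lam) ×ˢ (Zmed lam)).filter
      (fun p => P p.1 ∧ P p.2 ∧ e2 (p.1 - p.2) < lam ^ ε),
    ‖b p.1‖ * ‖b p.2‖ / Real.sqrt (max 1 (e2 (p.1 - p.2)))

/-- The potential controlling the part of the homogeneous kernel near the diagonal. -/
def nearPotential (m k : ℕ) : ℝ := 2 * ((min (k - (m - 2)) 3 : ℕ) : ℝ)

/-- The potential controlling the part of the homogeneous kernel below the diagonal. -/
def lowPotential (m k : ℕ) : ℝ :=
  4 / √(m : ℝ) * (√((min k m : ℕ) : ℝ) - √((m - k - 1 : ℕ) : ℝ))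

/-- The potential controlling the part of the homogeneous kernel above the diagonal. -/
def highPotential (m k : ℕ) : ℝ :=
  8 * (√((k - m : ℕ) : ℝ) / (√(m : ℝ) + √((k - m : ℕ) : ℝ)))

lemma nearPotential_mono (m : ℕ) : Monotone (nearPotential m) := by
  intro a b h
  unfold nearPotential
  have : min (a - (m - 2)) 3 ≤ min (b - (m - 2)) 3 := by omega
  gcongr

lemma lowPotential_mono (m : ℕ) : Monotone (lowPotential m) := by
  intro a b h
  unfold lowPotential
  have h1 : min a m ≤ min b m := by omega
  have h2 : m - b - 1 ≤ m - a - 1 := by omega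
  gcongr

lemma highPotential_mono (m : ℕ) (hm : 1 ≤ m) : Monotone (highPotential m) := by
  intro a b h
  unfold highPotential
  have hm' : (0 : ℝ) < √(m : ℝ) := Real.sqrt_pos.2 (by exact_mod_cast hm)
  have h1 : √((a - m : ℕ) : ℝ) ≤ √((b - m : ℕ) : ℝ) := by
    have : a - m ≤ b - m := by omega
    gcongr
  have ha := Real.sqrt_nonneg ((a - m : ℕ) : ℝ)
  have : √((a - m : ℕ) : ℝ) / (√(m : ℝ) + √((a - m : ℕ) : ℝ)) ≤
      √((b - m : ℕ) : ℝ) / (√(m : ℝ) + √((b - m : ℕ) : ℝ)) := by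
    rw [div_le_div_iff₀ (by linarith) (by linarith)]
    nlinarith
  linarith

lemma inv_sqrt_le_two_mul_sqrt_sub {x : ℝ} (hx : 1 ≤ x) : 1 / √x ≤ 2 * (√x - √(x - 1)) := by
  have hx0 : 0 < √x := Real.sqrt_pos.2 (by linarith)
  rw [div_le_iff₀ hx0]
  nlinarith [Real.sq_sqrt (show 0 ≤ x by linarith), Real.sq_sqrt (show 0 ≤ x - 1 by linarith),
    sq_nonneg (√x - √(x - 1))]

lemma kernel_le_low {m k : ℕ} {X : ℝ} (hk : 1 ≤ k) (h : k + 2 ≤ m)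
    (hX : ((m : ℝ) - k - 1) * (k + m) / 2 ≤ X) :
    √((m : ℝ) / k) / √X ≤ lowPotential m k - lowPotential m (k - 1) := by
  obtain ⟨j, rfl⟩ : ∃ j, k = j + 1 := ⟨k - 1, by omega⟩
  obtain ⟨i, rfl⟩ : ∃ i, m = j + i + 3 := ⟨m - j - 3, by omega⟩
  unfold lowPotential
  rw [show min (j + 1) (j + i + 3) = j + 1 by omega,
    show min (j + 1 - 1) (j + i + 3) = j by omega,
    show j + i + 3 - (j + 1) - 1 = i + 1 by omega,
    show j + i + 3 - (j + 1 - 1) - 1 = i + 2 by omega]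
  push_cast at hX ⊢
  have hj : (0 : ℝ) ≤ j := by positivity
  have hi : (0 : ℝ) ≤ i := by positivity
  set a : ℝ := (j : ℝ) + 1 with ha
  set d : ℝ := (i : ℝ) + 2 with hd
  have hm : (j : ℝ) + i + 3 = a + d := by rw [ha, hd]; ring
  rw [hm] at hX ⊢
  have e1 : (j : ℝ) = a - 1 := by rw [ha]; ring
  have e2 : (i : ℝ) + 1 = d - 1 := by rw [hd]; ring
  rw [e1, e2]
  have ha1 : 1 ≤ a := by linarith
  have hd1 : 2 ≤ d := by linarith
  have hX' : d * (a + d) / 4 ≤ X := by nlinarith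
  have hsa := inv_sqrt_le_two_mul_sqrt_sub ha1
  have hsd := inv_sqrt_le_two_mul_sqrt_sub (show 1 ≤ d by linarith)
  have hA : 0 < √a := Real.sqrt_pos.2 (by linarith)
  have hD : 0 < √d := Real.sqrt_pos.2 (by linarith)
  have hM : 0 < √(a + d) := Real.sqrt_pos.2 (by linarith)
  have key : √((a + d) / a) / √X ≤ 2 / √(a + d) * (1 / √a + 1 / √d) := by
    rw [← Real.sqrt_div (by positivity)]
    apply Real.sqrt_le_iff.2
    refine ⟨by positivity, ?_⟩
    have hXp : 0 < X := lt_of_lt_of_le (by positivity) hX'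
    calc (a + d) / a / X ≤ (a + d) / a / (d * (a + d) / 4) := by gcongr
      _ = 4 / (a + d) * (1 / a + 1 / d) := by
          field_simp
          ring
      _ ≤ 4 / (a + d) * (1 / √a + 1 / √d) ^ 2 := by
          have : 1 / a + 1 / d ≤ (1 / √a + 1 / √d) ^ 2 := by
            have h1 : (1 / √a) ^ 2 = 1 / a := by
              rw [div_pow, Real.sq_sqrt (by linarith)]; simp
            have h2 : (1 / √d) ^ 2 = 1 / d := by
              rw [div_pow, Real.sq_sqrt (by linarith)]; simp
            have h3 : 0 ≤ 1 / √a * (1 / √d) := by positivity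
            nlinarith
          gcongr
      _ = (2 / √(a + d) * (1 / √a + 1 / √d)) ^ 2 := by
          rw [mul_pow, div_pow, Real.sq_sqrt (by linarith)]; norm_num
  refine key.trans ?_
  have : 2 / √(a + d) * (1 / √a + 1 / √d) ≤
      2 / √(a + d) * (2 * (√a - √(a - 1)) + 2 * (√d - √(d - 1))) := by gcongr
  refine this.trans (le_of_eq ?_)
  ring

lemma kernel_le_high {m k : ℕ} {X : ℝ} (hm : 1 ≤ m) (h : m + 2 ≤ k)
    (hX : ((k : ℝ) - m - 1) * (k + m) / 2 ≤ X) :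
    √((m : ℝ) / k) / √X ≤ highPotential m k - highPotential m (k - 1) := by
  obtain ⟨i, rfl⟩ : ∃ i, k = m + i + 2 := ⟨k - m - 2, by omega⟩
  unfold highPotential
  rw [show m + i + 2 - m = i + 2 by omega, show m + i + 2 - 1 - m = i + 1 by omega]
  push_cast at hX ⊢
  have hi : (0 : ℝ) ≤ i := by positivity
  have hm' : (1 : ℝ) ≤ m := by exact_mod_cast hm
  generalize (m : ℝ) = M at *
  set d : ℝ := (i : ℝ) + 2 with hd
  rw [show (i : ℝ) + 1 = d - 1 by rw [hd]; ring, show M + i + 2 = M + d by rw [hd]; ring]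
  rw [show M + i + 2 = M + d by rw [hd]; ring] at hX
  have hd2 : 2 ≤ d := by linarith
  have hX' : d * (M + d) / 4 ≤ X := by nlinarith
  have hsd := inv_sqrt_le_two_mul_sqrt_sub (show 1 ≤ d by linarith)
  have hD : 0 < √d := Real.sqrt_pos.2 (by linarith)
  have hD' : 0 < √(d - 1) := Real.sqrt_pos.2 (by linarith)
  have hDD : √(d - 1) ≤ √d := Real.sqrt_le_sqrt (by linarith)
  have hM : 0 < √M := Real.sqrt_pos.2 (by linarith)
  have qD := Real.sq_sqrt (show 0 ≤ d by linarith)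
  have qM := Real.sq_sqrt (show 0 ≤ M by linarith)
  have key : √(M / (M + d)) / √X ≤ 2 * √M / (√d * (M + d)) := by
    rw [← Real.sqrt_div (by positivity)]
    apply Real.sqrt_le_iff.2
    refine ⟨by positivity, ?_⟩
    have hXp : 0 < X := lt_of_lt_of_le (by positivity) hX'
    calc M / (M + d) / X ≤ M / (M + d) / (d * (M + d) / 4) := by gcongr
      _ = 2 ^ 2 * M / (d * (M + d) ^ 2) := by
          field_simp
          ring
      _ = _ := by rw [div_pow, mul_pow, mul_pow, qD, qM]
  refine key.trans ?_
  have e : 8 * (√d / (√M + √d)) - 8 * (√(d - 1) / (√M + √(d - 1))) =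
      8 * √M * (√d - √(d - 1)) / ((√M + √d) * (√M + √(d - 1))) := by
    field_simp
    ring
  rw [e]
  calc 2 * √M / (√d * (M + d)) = 8 * √M * (1 / √d / 2) / (2 * (M + d)) := by
        field_simp
        norm_num
    _ ≤ 8 * √M * (√d - √(d - 1)) / ((√M + √d) * (√M + √(d - 1))) := by
        have h0 : 0 ≤ √d - √(d - 1) := by linarith
        have hden : (√M + √d) * (√M + √(d - 1)) ≤ 2 * (M + d) := by
          nlinarith [sq_nonneg (√M - √d)]
        have hnum : 1 / √d / 2 ≤ √d - √(d - 1) := by linarith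
        exact div_le_div₀ (by positivity) (by gcongr) (by positivity) hden

/-- A bounded monotone function of `k` whose increments dominate `√(m / k) * |k² - m²|^(-1/2)`. -/
def kernelPotential (m k : ℕ) : ℝ := nearPotential m k + lowPotential m k + highPotential m k

lemma kernelPotential_mono (m : ℕ) (hm : 1 ≤ m) : Monotone (kernelPotential m) :=
  ((nearPotential_mono m).add (lowPotential_mono m)).add (highPotential_mono m hm)

lemma kernel_le_potential {m k : ℕ} {X : ℝ} (hm : 1 ≤ m) (hk : 1 ≤ k) (hX1 : 1 ≤ X)
    (hX : (|(k : ℝ) - m| - 1) * (k + m) / 2 ≤ X) :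
    √((m : ℝ) / k) / √X ≤
      kernelPotential m k - kernelPotential m (k - 1) := by
  unfold kernelPotential
  have h1 := nearPotential_mono m (Nat.sub_le k 1)
  have h2 := lowPotential_mono m (Nat.sub_le k 1)
  have h3 := highPotential_mono m hm (Nat.sub_le k 1)
  rcases le_or_gt (k + 2) m with h | h
  · have hc : (k : ℝ) + 2 ≤ m := by exact_mod_cast h
    rw [abs_of_nonpos (by linarith)] at hX
    have := kernel_le_low (X := X) hk h (by linarith)
    linarith
  rcases le_or_gt (m + 2) k with h' | h'
  · have hc : (m : ℝ) + 2 ≤ k := by exact_mod_cast h'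
    rw [abs_of_nonneg (by linarith)] at hX
    have := kernel_le_high (X := X) hm h' (by linarith)
    linarith
  have hX' : 1 ≤ √X := Real.one_le_sqrt.2 hX1
  have hk' : (0 : ℝ) < k := by exact_mod_cast hk
  have hmk : (m : ℝ) ≤ 2 * k := by
    have : m ≤ 2 * k := by omega
    exact_mod_cast this
  have hs : √((m : ℝ) / k) ≤ 2 := by
    apply Real.sqrt_le_iff.2
    refine ⟨by norm_num, ?_⟩
    rw [div_le_iff₀ hk']
    linarith
  have hq : √((m : ℝ) / k) / √X ≤ 2 := (div_le_self (Real.sqrt_nonneg _) hX').trans hs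
  have hnear : nearPotential m k - nearPotential m (k - 1) = 2 := by
    unfold nearPotential
    have : min (k - (m - 2)) 3 = min (k - 1 - (m - 2)) 3 + 1 := by omega
    rw [this]
    push_cast
    ring
  linarith

lemma kernelPotential_sub_le {m M : ℕ} (hm : 1 ≤ m) :
    kernelPotential m M - kernelPotential m 0 ≤ 22 := by
  unfold kernelPotential
  have hm' : (0 : ℝ) < √(m : ℝ) := Real.sqrt_pos.2 (by exact_mod_cast hm)
  have h1 : nearPotential m M - nearPotential m 0 ≤ 6 := by
    unfold nearPotential
    have : ((min (M - (m - 2)) 3 : ℕ) : ℝ) ≤ 3 := by exact_mod_cast min_le_right _ _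
    have : (0 : ℝ) ≤ ((min (0 - (m - 2)) 3 : ℕ) : ℝ) := by positivity
    linarith
  have h2 : lowPotential m M - lowPotential m 0 ≤ 8 := by
    unfold lowPotential
    rw [← mul_sub, div_mul_eq_mul_div, div_le_iff₀ hm']
    have a1 : √((min M m : ℕ) : ℝ) ≤ √(m : ℝ) :=
      Real.sqrt_le_sqrt (by exact_mod_cast min_le_right _ _)
    have a2 : √((m - 0 - 1 : ℕ) : ℝ) ≤ √(m : ℝ) :=
      Real.sqrt_le_sqrt (by exact_mod_cast (by omega : m - 0 - 1 ≤ m))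
    have a3 := Real.sqrt_nonneg ((m - M - 1 : ℕ) : ℝ)
    have a4 := Real.sqrt_nonneg ((min 0 m : ℕ) : ℝ)
    linarith
  have h3 : highPotential m M - highPotential m 0 ≤ 8 := by
    unfold highPotential
    have a3 := Real.sqrt_nonneg ((M - m : ℕ) : ℝ)
    have : √((M - m : ℕ) : ℝ) / (√(m : ℝ) + √((M - m : ℕ) : ℝ)) ≤ 1 := by
      rw [div_le_one (by linarith)]
      linarith
    have : 0 ≤ √((0 - m : ℕ) : ℝ) / (√(m : ℝ) + √((0 - m : ℕ) : ℝ)) := by positivity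
    linarith
  linarith

/-- A vector of the plane as a complex number. -/
def planeToComplex (x : ℝ × ℝ) : ℂ := ⟨x.1, x.2⟩

lemma e2_eq_norm (x : ℝ × ℝ) : e2 x = ‖planeToComplex x‖ := by
  rw [Complex.norm_eq_sqrt_sq_add_sq]
  rfl

lemma e2_nonneg (x : ℝ × ℝ) : 0 ≤ e2 x := Real.sqrt_nonneg _

lemma e2_sq (x : ℝ × ℝ) : e2 x ^ 2 = x.1 ^ 2 + x.2 ^ 2 := Real.sq_sqrt (by positivity)

lemma e2_add_le (x y : ℝ × ℝ) : e2 (x + y) ≤ e2 x + e2 y := by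
  simp only [e2_eq_norm]
  exact norm_add_le (planeToComplex x) (planeToComplex y)

lemma e2_smul (t : ℝ) (x : ℝ × ℝ) : e2 (t • x) = |t| * e2 x := by
  unfold e2
  rw [← Real.sqrt_sq_eq_abs, ← Real.sqrt_mul (sq_nonneg t)]
  congr 1
  simp only [Prod.smul_fst, Prod.smul_snd, smul_eq_mul]
  ring

lemma e2_perp (x : ℝ × ℝ) : e2 (perp x) = e2 x := by
  unfold e2 perp
  congr 1
  ring

lemma e2_sub_comm (x y : ℝ × ℝ) : e2 (x - y) = e2 (y - x) := by
  unfold e2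
  congr 1
  simp only [Prod.fst_sub, Prod.snd_sub]
  ring

lemma abs_e2_sub_le (x y : ℝ × ℝ) : |e2 x - e2 y| ≤ e2 (x - y) := by
  simp only [e2_eq_norm]
  exact abs_norm_sub_norm_le (planeToComplex x) (planeToComplex y)

lemma abs_fst_le_e2 (x : ℝ × ℝ) : |x.1| ≤ e2 x :=
  Real.abs_le_sqrt (by nlinarith [sq_nonneg x.2])

lemma abs_snd_le_e2 (x : ℝ × ℝ) : |x.2| ≤ e2 x :=
  Real.abs_le_sqrt (by nlinarith [sq_nonneg x.1])

lemma e2_iv_of_mem_Elat {lam : ℝ} (hlam : 0 ≤ lam) {ξ : ℤ × ℤ} (h : ξ ∈ Elat lam) :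
    e2 (iv ξ) = lam := by
  classical
  unfold Elat at h
  have := (Finset.mem_filter.1 h).2
  unfold e2 iv
  simp only [this]
  exact Real.sqrt_sq hlam

lemma sq_add_sq_of_mem_Elat {lam : ℝ} {ξ : ℤ × ℤ} (h : ξ ∈ Elat lam) :
    (ξ.1 : ℝ) ^ 2 + (ξ.2 : ℝ) ^ 2 = lam ^ 2 := by
  classical
  unfold Elat at h
  exact (Finset.mem_filter.1 h).2

open Classical in
lemma card_le_Bmax {lam : ℝ} (hlam : 0 ≤ lam) {ξ₀ : ℤ × ℤ} (h : ξ₀ ∈ Elat lam) :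
    ((Elat lam).filter fun ξ => e2 (iv ξ - iv ξ₀) ≤ √lam).card ≤ Bmax lam := by
  unfold Bmax
  apply le_csSup
  · refine ⟨(Elat lam).card, ?_⟩
    rintro n ⟨x, -, rfl⟩
    exact Finset.card_filter_le _ _
  · exact ⟨iv ξ₀, e2_iv_of_mem_Elat hlam h, rfl⟩

open Classical in
/-- A set of lattice points in a disc of radius `a * r` with at most `n` points in any disc of
radius `r` about one of its points has `O(a ^ 2 * n)` elements. -/
lemma card_le_of_local_bound (S : Finset (ℤ × ℤ)) (y : ℝ × ℝ) (a n : ℕ) {r : ℝ} (hr : 0 < r)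
    (hS : ∀ ξ ∈ S, e2 (iv ξ - y) ≤ a * r)
    (hloc : ∀ ξ₀ ∈ S, (S.filter fun ξ => e2 (iv ξ - iv ξ₀) ≤ r).card ≤ n) :
    S.card ≤ n * (4 * a + 1) ^ 2 := by
  have hmap : ∀ ξ ∈ S, ((⌊2 * (iv ξ - y).1 / r⌋, ⌊2 * (iv ξ - y).2 / r⌋) : ℤ × ℤ) ∈
      (Finset.Icc (-(2 * a : ℤ)) (2 * a)) ×ˢ (Finset.Icc (-(2 * a : ℤ)) (2 * a)) := by
    have aux : ∀ t : ℝ, |t| ≤ a * r → ⌊2 * t / r⌋ ∈ Finset.Icc (-(2 * a : ℤ)) (2 * a) := by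
      intro t ht
      obtain ⟨h1, h2⟩ := abs_le.1 ht
      rw [Finset.mem_Icc]
      constructor
      · rw [Int.le_floor, le_div_iff₀ hr]
        push_cast
        linarith
      · have : (⌊2 * t / r⌋ : ℝ) ≤ 2 * a := by
          refine (Int.floor_le _).trans ?_
          rw [div_le_iff₀ hr]
          linarith
        exact_mod_cast this
    intro ξ hξ
    rw [Finset.mem_product]
    exact ⟨aux _ ((abs_fst_le_e2 _).trans (hS ξ hξ)), aux _ ((abs_snd_le_e2 _).trans (hS ξ hξ))⟩
  have hclose : ∀ s t : ℝ, ⌊2 * s / r⌋ = ⌊2 * t / r⌋ → (s - t) ^ 2 ≤ r ^ 2 / 4 := by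
    intro s t h
    have := Int.abs_sub_lt_one_of_floor_eq_floor h
    have h2 : |s - t| < r / 2 := by
      have e : 2 * s / r - 2 * t / r = (s - t) * (2 / r) := by ring
      rw [e, abs_mul, abs_of_pos (show 0 < 2 / r by positivity)] at this
      calc |s - t| = |s - t| * (2 / r) * (r / 2) := by field_simp
        _ < 1 * (r / 2) := by gcongr
        _ = r / 2 := one_mul _
    have := sq_lt_sq' (by linarith [abs_nonneg (s - t)] : -(r / 2) < |s - t|) h2
    rw [sq_abs] at this
    linarith
  have := Finset.card_le_mul_card_image_of_maps_to hmap n (by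
    intro q _
    rcases (S.filter fun ξ =>
      ((⌊2 * (iv ξ - y).1 / r⌋, ⌊2 * (iv ξ - y).2 / r⌋) : ℤ × ℤ) = q).eq_empty_or_nonempty
      with h | ⟨ξ₀, h₀⟩
    · rw [h]; simp
    · obtain ⟨h₀S, h₀q⟩ := Finset.mem_filter.1 h₀
      refine le_trans (Finset.card_le_card ?_) (hloc ξ₀ h₀S)
      intro ξ hξ
      obtain ⟨hξS, hξq⟩ := Finset.mem_filter.1 hξ
      refine Finset.mem_filter.2 ⟨hξS, ?_⟩
      rw [← h₀q, Prod.mk.injEq] at hξq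
      have c1 := hclose _ _ hξq.1
      have c2 := hclose _ _ hξq.2
      apply Real.sqrt_le_iff.2
      refine ⟨hr.le, ?_⟩
      simp only [Prod.fst_sub, Prod.snd_sub, sub_sub_sub_cancel_right] at c1 c2 ⊢
      nlinarith)
  refine this.trans (le_of_eq ?_)
  rw [Finset.card_product, Int.card_Icc]
  have : ((2 * a : ℤ) + 1 - -(2 * a)).toNat = 4 * a + 1 := by omega
  rw [this, sq]

/-- The circumradius formula for a lattice triangle bounds the product of its sides from below. -/
lemma four_mul_sq_le_sides {lam : ℝ} {ξ η ζ : ℤ × ℤ} (hξ : ξ ∈ Elat lam) (hη : η ∈ Elat lam)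
    (hζ : ζ ∈ Elat lam) (hξη : ξ ≠ η) (hξζ : ξ ≠ ζ) (hηζ : η ≠ ζ) :
    4 * lam ^ 2 ≤ e2 (iv η - iv ξ) ^ 2 * e2 (iv ζ - iv ξ) ^ 2 * e2 (iv η - iv ζ) ^ 2 := by
  have q1 := sq_add_sq_of_mem_Elat hξ
  have q2 := sq_add_sq_of_mem_Elat hη
  have q3 := sq_add_sq_of_mem_Elat hζ
  have pos : ∀ p q : ℤ × ℤ, p ≠ q → 0 < e2 (iv p - iv q) ^ 2 := by
    intro p q hpq
    rw [e2_sq]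
    simp only [iv, Prod.fst_sub, Prod.snd_sub]
    by_contra! hle
    have z1 : ((p.1 : ℝ) - q.1) ^ 2 = 0 := le_antisymm (by nlinarith [sq_nonneg ((p.2 : ℝ) - q.2)])
      (sq_nonneg _)
    have z2 : ((p.2 : ℝ) - q.2) ^ 2 = 0 := le_antisymm (by nlinarith [sq_nonneg ((p.1 : ℝ) - q.1)])
      (sq_nonneg _)
    apply hpq
    ext
    · exact_mod_cast sub_eq_zero.1 (pow_eq_zero_iff two_ne_zero |>.1 z1)
    · exact_mod_cast sub_eq_zero.1 (pow_eq_zero_iff two_ne_zero |>.1 z2)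
  have hpos := mul_pos (mul_pos (pos η ξ hξη.symm) (pos ζ ξ hξζ.symm)) (pos η ζ hηζ)
  set D : ℤ := (η.1 - ξ.1) * (ζ.2 - ξ.2) - (η.2 - ξ.2) * (ζ.1 - ξ.1) with hD
  have key : 4 * (D : ℝ) ^ 2 * lam ^ 2 =
      e2 (iv η - iv ξ) ^ 2 * e2 (iv ζ - iv ξ) ^ 2 * e2 (iv η - iv ζ) ^ 2 := by
    simp only [e2_sq, iv, Prod.fst_sub, Prod.snd_sub, hD]
    push_cast
    obtain ⟨u1, hu1⟩ : ∃ u : ℝ, (η.1 : ℝ) = ξ.1 + u := ⟨η.1 - ξ.1, by ring⟩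
    obtain ⟨u2, hu2⟩ : ∃ u : ℝ, (η.2 : ℝ) = ξ.2 + u := ⟨η.2 - ξ.2, by ring⟩
    obtain ⟨v1, hv1⟩ : ∃ u : ℝ, (ζ.1 : ℝ) = ξ.1 + u := ⟨ζ.1 - ξ.1, by ring⟩
    obtain ⟨v2, hv2⟩ : ∃ u : ℝ, (ζ.2 : ℝ) = ξ.2 + u := ⟨ζ.2 - ξ.2, by ring⟩
    rw [hu1, hu2] at q2 ⊢
    rw [hv1, hv2] at q3 ⊢
    generalize (ξ.1 : ℝ) = x at *
    generalize (ξ.2 : ℝ) = y at *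
    have hu : u1 ^ 2 + u2 ^ 2 = -2 * (x * u1 + y * u2) := by linarith
    have hv : v1 ^ 2 + v2 ^ 2 = -2 * (x * v1 + y * v2) := by linarith
    have e1 : (x + u1 - x) = u1 := by ring
    have e2 : (y + u2 - y) = u2 := by ring
    have e3 : (x + v1 - x) = v1 := by ring
    have e4 : (y + v2 - y) = v2 := by ring
    have e5 : (x + u1 - (x + v1)) ^ 2 + (y + u2 - (y + v2)) ^ 2 =
      (u1 ^ 2 + u2 ^ 2) + (v1 ^ 2 + v2 ^ 2) - 2 * (u1 * v1 + u2 * v2) := by ring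
    rw [e1, e2, e3, e4, e5]
    have hid : (u1 ^ 2 + u2 ^ 2) * (v1 ^ 2 + v2 ^ 2) *
        ((u1 ^ 2 + u2 ^ 2) + (v1 ^ 2 + v2 ^ 2) - 2 * (u1 * v1 + u2 * v2)) =
        (u1 ^ 2 + u2 ^ 2) ^ 2 * (v1 ^ 2 + v2 ^ 2) + (v1 ^ 2 + v2 ^ 2) ^ 2 * (u1 ^ 2 + u2 ^ 2) -
        2 * (u1 ^ 2 + u2 ^ 2) * (v1 ^ 2 + v2 ^ 2) * (u1 * v1 + u2 * v2) := by ring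
    have hid' : (u1 ^ 2 + u2 ^ 2) ^ 2 * (v1 ^ 2 + v2 ^ 2) +
        (v1 ^ 2 + v2 ^ 2) ^ 2 * (u1 ^ 2 + u2 ^ 2) -
        2 * (u1 ^ 2 + u2 ^ 2) * (v1 ^ 2 + v2 ^ 2) * (u1 * v1 + u2 * v2) =
        (-2 * (x * u1 + y * u2)) ^ 2 * (v1 ^ 2 + v2 ^ 2) +
        (-2 * (x * v1 + y * v2)) ^ 2 * (u1 ^ 2 + u2 ^ 2) -
        2 * (-2 * (x * u1 + y * u2)) * (-2 * (x * v1 + y * v2)) * (u1 * v1 + u2 * v2) := by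
      rw [← hu, ← hv]
    rw [hid, hid', ← q1]
    ring
  have hDne : D ≠ 0 := by
    intro h0
    rw [← key, h0] at hpos
    simp at hpos
  have hD1 : (1 : ℝ) ≤ (D : ℝ) ^ 2 := by
    have : 0 < D ^ 2 := by positivity
    exact_mod_cast this
  rw [← key]
  nlinarith [sq_nonneg lam]

open Classical in
lemma card_short_arc_le_two {lam r : ℝ} (hr : r ^ 3 < lam) (hr0 : 0 ≤ r) {ξ₀ : ℤ × ℤ}
    (h : ξ₀ ∈ Elat lam) : ((Elat lam).filter fun ξ => e2 (iv ξ - iv ξ₀) ≤ r).card ≤ 2 := by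
  by_contra! hcard
  have hmem : ξ₀ ∈ (Elat lam).filter fun ξ => e2 (iv ξ - iv ξ₀) ≤ r := by
    refine Finset.mem_filter.2 ⟨h, ?_⟩
    simpa [e2] using hr0
  have : 1 < (((Elat lam).filter fun ξ => e2 (iv ξ - iv ξ₀) ≤ r).erase ξ₀).card := by
    rw [Finset.card_erase_of_mem hmem]
    omega
  obtain ⟨η, hη, ζ, hζ, hne⟩ := Finset.one_lt_card.1 this
  obtain ⟨hη0, hη⟩ := Finset.mem_erase.1 hη
  obtain ⟨hζ0, hζ⟩ := Finset.mem_erase.1 hζ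
  obtain ⟨hηE, hηr⟩ := Finset.mem_filter.1 hη
  obtain ⟨hζE, hζr⟩ := Finset.mem_filter.1 hζ
  have key := four_mul_sq_le_sides h hηE hζE hη0.symm hζ0.symm hne
  have h3 : e2 (iv η - iv ζ) ≤ 2 * r := by
    have := e2_add_le (iv η - iv ξ₀) (iv ξ₀ - iv ζ)
    rw [sub_add_sub_cancel, e2_sub_comm (iv ξ₀)] at this
    linarith
  have hle : e2 (iv η - iv ξ₀) ^ 2 * e2 (iv ζ - iv ξ₀) ^ 2 * e2 (iv η - iv ζ) ^ 2 ≤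
      r ^ 2 * r ^ 2 * (2 * r) ^ 2 := by
    have := e2_nonneg (iv η - iv ξ₀)
    have := e2_nonneg (iv ζ - iv ξ₀)
    have := e2_nonneg (iv η - iv ζ)
    gcongr
  have : r ^ 2 * r ^ 2 * (2 * r) ^ 2 = 4 * (r ^ 3) ^ 2 := by ring
  have h0 : 0 ≤ r ^ 3 := by positivity
  nlinarith

lemma exists_eq_mup {lam : ℝ} {w : ℝ × ℝ} (hw : w ∈ Zmed lam) (hpos : 0 < e2 w) :
    ∃ μ ∈ Elat lam, ∃ ν ∈ Elat lam, iv ν = (2 : ℝ) • w - iv μ ∧ iv μ = mup lam w := by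
  classical
  unfold Zmed at hw
  obtain ⟨⟨μ, ν⟩, hp, hwe⟩ := Finset.mem_image.1 hw
  obtain ⟨hμ, hν⟩ := Finset.mem_product.1 hp
  have q1 := sq_add_sq_of_mem_Elat hμ
  have q2 := sq_add_sq_of_mem_Elat hν
  simp only at q1 q2 hμ hν
  have w1 : w.1 = ((μ.1 : ℝ) + ν.1) / 2 := by
    rw [← hwe]; simp [iv]; ring
  have w2 : w.2 = ((μ.2 : ℝ) + ν.2) / 2 := by
    rw [← hwe]; simp [iv]; ring
  set d1 : ℝ := ((μ.1 : ℝ) - ν.1) / 2 with hd1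
  set d2 : ℝ := ((μ.2 : ℝ) - ν.2) / 2 with hd2
  have horth : w.1 * d1 + w.2 * d2 = 0 := by rw [w1, w2, hd1, hd2]; linarith
  have hes := e2_sq w
  have hd : d1 ^ 2 + d2 ^ 2 = lam ^ 2 - e2 w ^ 2 := by
    rw [hes, w1, w2, hd1, hd2]; linarith
  have hDel : Del lam w ^ 2 = d1 ^ 2 + d2 ^ 2 := by
    unfold Del
    rw [← hd, Real.sq_sqrt (by positivity)]
  have hne : e2 w ≠ 0 := hpos.ne'
  have hsq : e2 w ^ 2 ≠ 0 := pow_ne_zero _ hne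
  set t : ℝ := (w.1 * d2 - w.2 * d1) / e2 w ^ 2 with ht
  have t1 : d1 = t * (-w.2) := by
    rw [ht, div_mul_eq_mul_div, eq_div_iff hsq, hes]
    linear_combination w.1 * horth
  have t2 : d2 = t * w.1 := by
    rw [ht, div_mul_eq_mul_div, eq_div_iff hsq, hes]
    linear_combination w.2 * horth
  have htt : t ^ 2 = (Del lam w / e2 w) ^ 2 := by
    clear_value t
    rw [div_pow, eq_div_iff hsq, hDel, hes, t1, t2]
    ring
  rcases sq_eq_sq_iff_eq_or_eq_neg.1 htt with h | h
  · refine ⟨μ, hμ, ν, hν, ?_, ?_⟩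
    · rw [← hwe, smul_smul]; norm_num
    · unfold mup perp
      rw [← h]
      ext
      · simp only [Prod.fst_add, Prod.smul_fst, smul_eq_mul, ← t1, w1, iv, hd1]; ring
      · simp only [Prod.snd_add, Prod.smul_snd, smul_eq_mul, ← t2, w2, iv, hd2]; ring
  · refine ⟨ν, hν, μ, hμ, ?_, ?_⟩
    · rw [← hwe, smul_smul]; norm_num
    · unfold mup perp
      rw [show Del lam w / e2 w = -t by linarith]
      ext
      · simp only [Prod.fst_add, Prod.smul_fst, smul_eq_mul, neg_mul t, ← t1, w1, iv, hd1]; ring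
      · simp only [Prod.snd_add, Prod.smul_snd, smul_eq_mul, neg_mul t, ← t2, w2, iv, hd2]; ring

lemma Del_nonneg (lam : ℝ) (z : ℝ × ℝ) : 0 ≤ Del lam z := Real.sqrt_nonneg _

lemma Del_le {lam : ℝ} (hlam : 0 ≤ lam) (z : ℝ × ℝ) : Del lam z ≤ lam :=
  Real.sqrt_le_iff.2 ⟨hlam, by nlinarith [sq_nonneg (e2 z)]⟩

lemma e2_mup_sub_le {lam s : ℝ} {z w : ℝ × ℝ} (hlam : 0 < lam) (hz : 0 < e2 z)
    (hw : lam / 2 ≤ e2 w) :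
    e2 (mup lam w - (z + (s / e2 z) • perp z)) ≤ 5 * e2 (w - z) + |Del lam w - s| := by
  have hw0 : 0 < e2 w := by linarith
  set t : ℝ := Del lam w / e2 w with ht
  have ht0 : 0 ≤ t := div_nonneg (Del_nonneg _ _) hw0.le
  have ht2 : t ≤ 2 := by
    rw [ht, div_le_iff₀ hw0]
    linarith [Del_le hlam.le w]
  have e : mup lam w - (z + (s / e2 z) • perp z) =
      (w - z) + (t • perp (w - z) + (t - s / e2 z) • perp z) := by
    unfold mup perp
    rw [← ht]
    ext
    · simp; ring
    · simp; ring
  rw [e]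
  have b3 : |t - s / e2 z| * e2 z ≤ t * e2 (w - z) + |Del lam w - s| := by
    have e3 : (t - s / e2 z) * e2 z = t * (e2 z - e2 w) + (Del lam w - s) := by
      have : t * e2 w = Del lam w := by rw [ht]; field_simp
      rw [sub_mul, div_mul_cancel₀ _ hz.ne', mul_sub, this]
      ring
    rw [← abs_of_pos hz, ← abs_mul, abs_of_pos hz, e3]
    refine (abs_add_le _ _).trans ?_
    rw [abs_mul, abs_of_nonneg ht0]
    have := abs_e2_sub_le z w
    rw [e2_sub_comm] at this
    gcongr
  have h1 := e2_add_le (w - z) (t • perp (w - z) + (t - s / e2 z) • perp z)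
  have h2 := e2_add_le (t • perp (w - z)) ((t - s / e2 z) • perp z)
  rw [e2_smul, e2_smul, e2_perp, e2_perp, abs_of_nonneg ht0] at h2
  nlinarith [e2_nonneg (w - z)]

open Classical in
lemma card_medians_le {lam R s : ℝ} (hlam : 1 ≤ lam) (hR : 0 < R) (hR3 : R ^ 3 ≤ lam)
    {z : ℝ × ℝ} (hz : lam / 2 ≤ e2 z) :
    ((Zmed lam).filter fun w =>
      lam / 2 ≤ e2 w ∧ e2 (z - w) < R ∧ |Del lam w - s| ≤ √lam).card ≤ 361250 * Bmax lam := by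
  have hlam0 : 0 < lam := by linarith
  have hs1 : 0 < √lam := Real.sqrt_pos.2 hlam0
  have hRs : R ≤ √lam := by
    apply Real.le_sqrt_of_sq_le
    rcases le_total R 1 with h | h
    · nlinarith
    · nlinarith [sq_nonneg R]
  set W := (Zmed lam).filter fun w =>
    lam / 2 ≤ e2 w ∧ e2 (z - w) < R ∧ |Del lam w - s| ≤ √lam with hW
  set y : ℝ × ℝ := z + (s / e2 z) • perp z with hy
  let T := (Elat lam).filter fun ξ => e2 (iv ξ - y) ≤ (6 : ℕ) * √lam
  let f : ℝ × ℝ → ℤ × ℤ := fun w => (⌊(mup lam w).1⌋, ⌊(mup lam w).2⌋)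
  let g : ℝ × ℝ → ℤ × ℤ := fun w =>
    (⌊((2 : ℝ) • w - mup lam w).1⌋, ⌊((2 : ℝ) • w - mup lam w).2⌋)
  have hfg : ∀ w ∈ W, f w ∈ Elat lam ∧ g w ∈ Elat lam ∧ iv (f w) = mup lam w ∧
      iv (g w) = (2 : ℝ) • w - iv (f w) := by
    intro w hw
    obtain ⟨hwZ, hw1, -, -⟩ := Finset.mem_filter.1 hw
    obtain ⟨μ, hμ, ν, hν, h1, h2⟩ := exists_eq_mup hwZ (by linarith)
    have ef : f w = μ := by
      simp only [f, ← h2]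
      ext <;> simp [iv]
    have eg : g w = ν := by
      simp only [g, ← h2, ← h1]
      ext <;> simp [iv]
    rw [ef, eg]
    exact ⟨hμ, hν, h2, h1⟩
  have hT : T.card ≤ Bmax lam * (4 * 6 + 1) ^ 2 := by
    refine card_le_of_local_bound T y 6 _ hs1 (fun ξ hξ => (Finset.mem_filter.1 hξ).2) ?_
    intro ξ₀ h₀
    refine le_trans (Finset.card_le_card ?_) (card_le_Bmax hlam0.le (Finset.mem_filter.1 h₀).1)
    exact Finset.filter_subset_filter _ (Finset.filter_subset _ _)
  have hmap : ∀ w ∈ W, f w ∈ T := by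
    intro w hw
    obtain ⟨h1, -, h3, -⟩ := hfg w hw
    obtain ⟨-, hw1, hw2, hw3⟩ := Finset.mem_filter.1 hw
    refine Finset.mem_filter.2 ⟨h1, ?_⟩
    rw [h3]
    have := e2_mup_sub_le (s := s) hlam0 (show 0 < e2 z by linarith) hw1
    rw [e2_sub_comm w z] at this
    push_cast
    linarith
  have hfib : ∀ μ ∈ T, (W.filter fun w => f w = μ).card ≤ 578 := by
    intro μ _
    let V := (Elat lam).filter fun ξ => e2 (iv ξ - ((2 : ℝ) • z - iv μ)) ≤ (4 : ℕ) * (R / 2)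
    have hV : V.card ≤ 2 * (4 * 4 + 1) ^ 2 := by
      refine card_le_of_local_bound V _ 4 2 (half_pos hR)
        (fun ξ hξ => (Finset.mem_filter.1 hξ).2) ?_
      intro ξ₀ h₀
      refine le_trans (Finset.card_le_card ?_) (card_short_arc_le_two (lam := lam) (r := R / 2) ?_
        (half_pos hR).le (Finset.mem_filter.1 h₀).1)
      · exact Finset.filter_subset_filter _ (Finset.filter_subset _ _)
      · rw [div_pow]
        linarith
    refine le_trans (Finset.card_le_card_of_injOn g ?_ ?_) hV
    · intro w hw
      obtain ⟨hwW, rfl⟩ := Finset.mem_filter.1 hw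
      obtain ⟨-, h2, -, h4⟩ := hfg w hwW
      obtain ⟨-, -, hw2, -⟩ := Finset.mem_filter.1 hwW
      refine Finset.mem_filter.2 ⟨h2, ?_⟩
      rw [h4, sub_sub_sub_cancel_right, ← smul_sub, e2_smul, e2_sub_comm, abs_two]
      push_cast
      linarith
    · intro w hw w' hw' hgg
      obtain ⟨hw, e⟩ := Finset.mem_filter.1 hw
      obtain ⟨hw', e'⟩ := Finset.mem_filter.1 hw'
      obtain ⟨-, -, -, h4⟩ := hfg w hw
      obtain ⟨-, -, -, h4'⟩ := hfg w' hw'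
      rw [e] at h4
      rw [e', ← hgg, h4] at h4'
      exact smul_right_injective _ (two_ne_zero (α := ℝ)) (sub_left_injective h4')
  have := Finset.card_le_mul_card_image_of_maps_to hmap 578 hfib
  omega

/-- Schur's test for a symmetric kernel on a finite set, with weight `q ^ (-1/2)`. -/
lemma schur_test {α : Type*} (T : Finset α) (K : α → α → ℝ) (q β : α → ℝ) (A : ℝ)
    (hK : ∀ z w, 0 ≤ K z w) (hsymm : ∀ z w, K z w = K w z) (hq : ∀ z ∈ T, 0 < q z)
    (hrow : ∀ z ∈ T, ∑ w ∈ T, K z w * √(q z / q w) ≤ A) :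
    ∑ z ∈ T, ∑ w ∈ T, β z * β w * K z w ≤ A * ∑ z ∈ T, β z ^ 2 := by
  have hpt : ∀ z ∈ T, ∀ w ∈ T, β z * β w * K z w ≤
      (1 / 2) * (β z ^ 2 * (K z w * √(q z / q w))) +
        (1 / 2) * (β w ^ 2 * (K w z * √(q w / q z))) := by
    intro z hz w hw
    have hqz := hq z hz
    have hqw := hq w hw
    have hx : 0 < √(q z / q w) := Real.sqrt_pos.2 (by positivity)
    have hinv : √(q w / q z) = (√(q z / q w))⁻¹ := by rw [← Real.sqrt_inv, inv_div]
    rw [hsymm w z, hinv]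
    set x := √(q z / q w)
    have hsq : β z * β w ≤ (1 / 2) * (β z ^ 2 * x + β w ^ 2 * x⁻¹) := by
      have e : (1 / 2) * (β z ^ 2 * x + β w ^ 2 * x⁻¹) - β z * β w =
          (β z * x - β w) ^ 2 / (2 * x) := by
        field_simp
        ring
      have : 0 ≤ (β z * x - β w) ^ 2 / (2 * x) := by positivity
      linarith
    have := mul_le_mul_of_nonneg_right hsq (hK z w)
    linarith
  have hhalf : ∑ z ∈ T, ∑ w ∈ T, β z ^ 2 * (K z w * √(q z / q w)) ≤ A * ∑ z ∈ T, β z ^ 2 := by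
    rw [Finset.mul_sum]
    refine Finset.sum_le_sum fun z hz => ?_
    rw [← Finset.mul_sum, mul_comm A]
    exact mul_le_mul_of_nonneg_left (hrow z hz) (sq_nonneg _)
  calc ∑ z ∈ T, ∑ w ∈ T, β z * β w * K z w
      ≤ ∑ z ∈ T, ∑ w ∈ T, ((1 / 2) * (β z ^ 2 * (K z w * √(q z / q w))) +
        (1 / 2) * (β w ^ 2 * (K w z * √(q w / q z)))) :=
        Finset.sum_le_sum fun z hz => Finset.sum_le_sum fun w hw => hpt z hz w hw
    _ = (1 / 2) * ∑ z ∈ T, ∑ w ∈ T, β z ^ 2 * (K z w * √(q z / q w)) +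
        (1 / 2) * ∑ w ∈ T, ∑ z ∈ T, β w ^ 2 * (K w z * √(q w / q z)) := by
        simp only [Finset.sum_add_distrib, Finset.mul_sum]
        congr 1
        exact Finset.sum_comm
    _ ≤ A * ∑ z ∈ T, β z ^ 2 := by linarith

/-- The index of the bin `[k√lam, (k+1)√lam)` containing `Δ(z)`. -/
def delBin (lam : ℝ) (z : ℝ × ℝ) : ℕ := ⌊Del lam z / √lam⌋₊

lemma one_le_delBin {lam : ℝ} (hlam : 0 < lam) {z : ℝ × ℝ} (hz : √lam < Del lam z) :
    1 ≤ delBin lam z := by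
  apply Nat.le_floor
  rw [Nat.cast_one, one_le_div (Real.sqrt_pos.2 hlam)]
  exact hz.le

lemma abs_Del_sub_le {lam : ℝ} (hlam : 0 < lam) (z : ℝ × ℝ) :
    |Del lam z - delBin lam z * √lam| ≤ √lam := by
  have hs := Real.sqrt_pos.2 hlam
  have h1 : (delBin lam z : ℝ) ≤ Del lam z / √lam :=
    Nat.floor_le (div_nonneg (Del_nonneg _ _) hs.le)
  have h2 : Del lam z / √lam < delBin lam z + 1 := Nat.lt_floor_add_one _
  rw [le_div_iff₀ hs] at h1
  rw [div_lt_iff₀ hs] at h2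
  rw [abs_le]
  constructor <;> linarith

lemma delBin_separation {lam : ℝ} (hlam : 0 < lam) {z w : ℝ × ℝ} (hz : √lam < Del lam z)
    (hw : √lam < Del lam w) :
    (|(delBin lam w : ℝ) - delBin lam z| - 1) * (delBin lam w + delBin lam z) / 2 ≤
      e2 (z - w) := by
  have hs := Real.sqrt_pos.2 hlam
  have hss := Real.sq_sqrt hlam.le
  have sq_Del : ∀ u, √lam < Del lam u → Del lam u ^ 2 = lam ^ 2 - e2 u ^ 2 ∧ e2 u ≤ lam := by
    intro u hu
    have hpos : 0 < lam ^ 2 - e2 u ^ 2 := Real.sqrt_pos.1 (hs.trans hu)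
    exact ⟨Real.sq_sqrt hpos.le, by nlinarith [e2_nonneg u]⟩
  obtain ⟨qz, lz⟩ := sq_Del z hz
  obtain ⟨qw, lw⟩ := sq_Del w hw
  have bounds : ∀ u, (delBin lam u : ℝ) ≤ Del lam u / √lam ∧
      Del lam u / √lam < delBin lam u + 1 := fun u =>
    ⟨Nat.floor_le (div_nonneg (Del_nonneg _ _) hs.le), Nat.lt_floor_add_one _⟩
  obtain ⟨z1, z2⟩ := bounds z
  obtain ⟨w1, w2⟩ := bounds w
  have eD : ∀ u, (Del lam u / √lam) ^ 2 = Del lam u ^ 2 / lam := by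
    intro u
    rw [div_pow, hss]
  have ez := eD z
  have ew := eD w
  set D := Del lam z / √lam
  set D' := Del lam w / √lam
  have hD : 0 ≤ D := le_trans (Nat.cast_nonneg _) z1
  have hD' : 0 ≤ D' := le_trans (Nat.cast_nonneg _) w1
  have h1 : |(delBin lam w : ℝ) - delBin lam z| - 1 ≤ |D' - D| := by
    rw [sub_le_iff_le_add, abs_le]
    constructor
    · linarith [neg_abs_le (D' - D)]
    · linarith [le_abs_self (D' - D)]
  have h2 : |D' - D| * (D' + D) ≤ 2 * e2 (z - w) := by
    have e : |D' - D| * (D' + D) = |e2 z - e2 w| * ((e2 z + e2 w) / lam) := by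
      rw [← abs_of_nonneg (add_nonneg hD' hD), ← abs_mul,
        ← abs_of_nonneg (div_nonneg (add_nonneg (e2_nonneg z) (e2_nonneg w)) hlam.le), ← abs_mul]
      congr 1
      have : (D' - D) * (D' + D) = D' ^ 2 - D ^ 2 := by ring
      rw [this, ez, ew, qz, qw]
      ring
    rw [e, mul_comm (2 : ℝ)]
    have h3 : (e2 z + e2 w) / lam ≤ 2 := by
      rw [div_le_iff₀ hlam]
      linarith
    have h4 : 0 ≤ (e2 z + e2 w) / lam := div_nonneg (add_nonneg (e2_nonneg z) (e2_nonneg w)) hlam.le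
    exact mul_le_mul (abs_e2_sub_le z w) h3 h4 (e2_nonneg _)
  have h3 : (|(delBin lam w : ℝ) - delBin lam z| - 1) * (delBin lam w + delBin lam z) ≤
      |D' - D| * (D' + D) :=
    mul_le_mul h1 (add_le_add w1 z1) (by positivity) (abs_nonneg _)
  linarith

open Classical in
lemma weighted_row_sum_le {lam R : ℝ} (hlam : 1 ≤ lam) (hR : 0 < R) (hR3 : R ^ 3 ≤ lam)
    {z : ℝ × ℝ} (hz : lam / 2 ≤ e2 z) (hzD : √lam < Del lam z) :
    ∑ w ∈ (Zmed lam).filter (fun w => (lam / 2 ≤ e2 w ∧ √lam < Del lam w) ∧ e2 (z - w) < R),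
      √((delBin lam z : ℝ) / delBin lam w) / √(max 1 (e2 (z - w))) ≤
        22 * 361250 * (Bmax lam : ℝ) := by
  have hlam0 : 0 < lam := by linarith
  set W := (Zmed lam).filter
    (fun w => (lam / 2 ≤ e2 w ∧ √lam < Del lam w) ∧ e2 (z - w) < R) with hW
  set m := delBin lam z with hmdef
  have hm : 1 ≤ m := one_le_delBin hlam0 hzD
  have hpt : ∀ w ∈ W, √((m : ℝ) / delBin lam w) / √(max 1 (e2 (z - w))) ≤
      kernelPotential m (delBin lam w) - kernelPotential m (delBin lam w - 1) := by
    intro w hw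
    obtain ⟨-, ⟨-, hwD⟩, -⟩ := Finset.mem_filter.1 hw
    exact kernel_le_potential hm (one_le_delBin hlam0 hwD) (le_max_left _ _)
      ((delBin_separation hlam0 hzD hwD).trans (le_max_right _ _))
  set M := W.sup (delBin lam) with hM
  have hmap : ∀ w ∈ W, delBin lam w - 1 ∈ Finset.range M := by
    intro w hw
    have h1 : delBin lam w ≤ M := Finset.le_sup hw
    obtain ⟨-, ⟨-, hwD⟩, -⟩ := Finset.mem_filter.1 hw
    have h2 := one_le_delBin hlam0 hwD
    rw [Finset.mem_range]
    omega
  have hcard : ∀ j, (W.filter fun w => delBin lam w - 1 = j).card ≤ 361250 * Bmax lam := by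
    intro j
    refine le_trans (Finset.card_le_card ?_)
      (card_medians_le (s := ((j + 1 : ℕ) : ℝ) * √lam) hlam hR hR3 hz)
    intro w hw
    obtain ⟨hwW, rfl⟩ := Finset.mem_filter.1 hw
    obtain ⟨hwZ, ⟨hw1, hwD⟩, hw2⟩ := Finset.mem_filter.1 hwW
    rw [Nat.sub_add_cancel (one_le_delBin hlam0 hwD)]
    exact Finset.mem_filter.2 ⟨hwZ, hw1, hw2, abs_Del_sub_le hlam0 w⟩
  calc ∑ w ∈ W, √((m : ℝ) / delBin lam w) / √(max 1 (e2 (z - w)))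
      ≤ ∑ w ∈ W, (kernelPotential m (delBin lam w) - kernelPotential m (delBin lam w - 1)) :=
        Finset.sum_le_sum hpt
    _ = ∑ j ∈ Finset.range M, ∑ w ∈ W with delBin lam w - 1 = j,
          (kernelPotential m (delBin lam w) - kernelPotential m (delBin lam w - 1)) :=
        (Finset.sum_fiberwise_of_maps_to hmap _).symm
    _ ≤ ∑ j ∈ Finset.range M, (361250 * (Bmax lam : ℝ)) *
          (kernelPotential m (j + 1) - kernelPotential m j) := by
        refine Finset.sum_le_sum fun j _ => ?_
        have hconst : ∀ w ∈ W.filter fun w => delBin lam w - 1 = j,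
            kernelPotential m (delBin lam w) - kernelPotential m (delBin lam w - 1) =
              kernelPotential m (j + 1) - kernelPotential m j := by
          intro w hw
          obtain ⟨hwW, rfl⟩ := Finset.mem_filter.1 hw
          obtain ⟨-, ⟨-, hwD⟩, -⟩ := Finset.mem_filter.1 hwW
          rw [Nat.sub_add_cancel (one_le_delBin hlam0 hwD)]
        rw [Finset.sum_congr rfl hconst, Finset.sum_const, nsmul_eq_mul]
        have := kernelPotential_mono m hm (Nat.le_succ j)
        refine mul_le_mul_of_nonneg_right ?_ (sub_nonneg.2 this)
        exact_mod_cast hcard j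
    _ = (361250 * (Bmax lam : ℝ)) * (kernelPotential m M - kernelPotential m 0) := by
        rw [← Finset.mul_sum, Finset.sum_range_sub]
    _ ≤ (361250 * (Bmax lam : ℝ)) * 22 := by
        gcongr
        exact kernelPotential_sub_le hm
    _ = 22 * 361250 * (Bmax lam : ℝ) := by ring

/-- Proposition 7.1(ii): the bilinear sum over pairs of medians with `|z| ≥ lam/2`,
`Δ(z) > √lam` which are `lam^ε`-close is bounded by `O(B_lam) · ‖b‖²`. -/
theorem bilinear_schur_large_Delta
    (ε : ℝ) (hε0 : 0 < ε) (hε : ε ≤ 1/3) :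
    ∃ C > (0:ℝ), ∃ lam0 > (0:ℝ), ∀ lam : ℝ, lam0 ≤ lam →
      ∀ b : ℝ × ℝ → ℂ,
        pairSum lam ε
            (fun z => lam / 2 ≤ e2 z ∧ Real.sqrt lam < Del lam z) b
          ≤ C * (Bmax lam : ℝ) * ∑ z ∈ Zmed lam, ‖b z‖ ^ 2 := by
  classical
  refine ⟨22 * 361250, by norm_num, 1, one_pos, fun lam hlam b => ?_⟩
  have hlam0 : 0 < lam := by linarith
  have hR : 0 < lam ^ ε := Real.rpow_pos_of_pos hlam0 _
  have hR3 : (lam ^ ε) ^ 3 ≤ lam := by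
    rw [← Real.rpow_natCast, ← Real.rpow_mul hlam0.le]
    calc lam ^ (ε * (3 : ℕ)) ≤ lam ^ (1 : ℝ) :=
          Real.rpow_le_rpow_of_exponent_le hlam (by push_cast; linarith)
      _ = lam := Real.rpow_one _
  set R := lam ^ ε with hRdef
  set T := (Zmed lam).filter fun z => lam / 2 ≤ e2 z ∧ √lam < Del lam z with hT
  let K : ℝ × ℝ → ℝ × ℝ → ℝ := fun z w =>
    if e2 (z - w) < R then 1 / √(max 1 (e2 (z - w))) else 0
  have hsum : pairSum lam ε (fun z => lam / 2 ≤ e2 z ∧ √lam < Del lam z) b =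
      ∑ z ∈ T, ∑ w ∈ T, ‖b z‖ * ‖b w‖ * K z w := by
    unfold pairSum
    rw [← Finset.sum_product', hT, ← Finset.filter_product, Finset.sum_filter, Finset.sum_filter]
    refine Finset.sum_congr rfl fun p _ => ?_
    simp only [K, ← hRdef]
    by_cases h1 : lam / 2 ≤ e2 p.1 ∧ √lam < Del lam p.1 <;>
    by_cases h2 : lam / 2 ≤ e2 p.2 ∧ √lam < Del lam p.2 <;>
    by_cases h3 : e2 (p.1 - p.2) < R <;>
    simp [h1, h2, h3, div_eq_mul_inv]
  have hK : ∀ z w, 0 ≤ K z w := by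
    intro z w
    simp only [K]
    split_ifs
    · positivity
    · exact le_rfl
  have hsymm : ∀ z w, K z w = K w z := by
    intro z w
    simp only [K, e2_sub_comm z w]
  rw [hsum]
  refine (schur_test T K (fun z => (delBin lam z : ℝ)) (fun z => ‖b z‖)
    (22 * 361250 * (Bmax lam : ℝ)) hK hsymm ?_ ?_).trans ?_
  · intro z hz
    have := one_le_delBin hlam0 (Finset.mem_filter.1 hz).2.2
    exact_mod_cast this
  · intro z hz
    obtain ⟨-, hz1, hzD⟩ := Finset.mem_filter.1 hz
    refine le_trans (le_of_eq ?_) (weighted_row_sum_le hlam hR hR3 hz1 hzD)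
    clear_value T
    rw [← Finset.filter_filter, ← hT, Finset.sum_filter]
    refine Finset.sum_congr rfl fun w _ => ?_
    simp only [K]
    split_ifs
    · ring
    · ring
  · gcongr
    exact Finset.filter_subset _ _
end
end
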